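/- arXiv:1709.09329 — 7 statements merged into one kernel-verified Lean document; each statement's English description precedes it below -/
import Mathlib

section
/- Let J ⊆ {1, …, m} with |J| = n+1 and assume B(0J) ≠ 0 (i.e. the centers O_j = −α_j, j ∈ J, are affinely independent). Then the n+1 complex hyperspheres S_j (j ∈ J) have a common point, i.e. there exists x ∈ ℂ^n with f_j(x) = 0 for all j ∈ J, if and only if B(0⋆J) = 0. -/
inductive CMIdx (m : ℕ) : Type
  | zero : CMIdx m
  | star : CMIdx m
  | pt : Fin m → CMIdx m

/-- Entry of the Cayley–Menger matrix with squared radii `rsq` and squared distances `ρsq`. -/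
def cmEnt {m : ℕ} (rsq : Fin m → ℝ) (ρsq : Fin m → Fin m → ℝ) : CMIdx m → CMIdx m → ℝ
  | CMIdx.zero, CMIdx.zero => 0
  | CMIdx.zero, _ => 1
  | _, CMIdx.zero => 1
  | CMIdx.star, CMIdx.star => 0
  | CMIdx.star, CMIdx.pt j => rsq j
  | CMIdx.pt j, CMIdx.star => rsq j
  | CMIdx.pt j, CMIdx.pt k => if j = k then 0 else ρsq j k

/-- Minor `B(rows ; cols)` of the Cayley–Menger matrix. -/
noncomputable def cmMinor {m : ℕ} (rsq : Fin m → ℝ) (ρsq : Fin m → Fin m → ℝ)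
    (rows cols : List (CMIdx m)) : ℝ :=
  if h : rows.length = cols.length then
    Matrix.det (Matrix.of fun i j : Fin rows.length =>
      cmEnt rsq ρsq (rows.get i) (cols.get (Fin.cast h j)))
  else 0

/-- `r_j² = Q(α_j) − α_{j0}`. -/
def sphereRsq {n m : ℕ} (α : Fin m → Fin n → ℝ) (α0 : Fin m → ℝ) : Fin m → ℝ :=
  fun j => (∑ ν, α j ν ^ 2) - α0 j

/-- `ρ_{jk}² = Q(α_j − α_k)`. -/
def sphereRhosq {n m : ℕ} (α : Fin m → Fin n → ℝ) : Fin m → Fin m → ℝ :=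
  fun j k => ∑ ν, (α j ν - α k ν) ^ 2

/-- The complex quadric `f_j(x) = Q(x) + 2(α_j, x) + α_{j0}`. -/
noncomputable def sphereFun {n m : ℕ} (α : Fin m → Fin n → ℝ) (α0 : Fin m → ℝ) (j : Fin m)
    (x : Fin n → ℂ) : ℂ :=
  (∑ ν, x ν ^ 2) + 2 * (∑ ν, (α j ν : ℂ) * x ν) + (α0 j : ℂ)

theorem cmMinor_ofFn {m k : ℕ} (rsq : Fin m → ℝ) (ρsq : Fin m → Fin m → ℝ)
    (g : Fin k → CMIdx m) :
    cmMinor rsq ρsq (List.ofFn g) (List.ofFn g)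
      = Matrix.det (Matrix.of fun i j : Fin k => cmEnt rsq ρsq (g i) (g j)) := by
  unfold cmMinor
  rw [dif_pos rfl, ← Matrix.det_submatrix_equiv_self (finCongr (List.length_ofFn (f := g)))]
  congr 1
  ext i j
  simp
  rfl

theorem cmMinor_zero_iff {m k : ℕ} (rsq : Fin m → ℝ) (ρsq : Fin m → Fin m → ℝ)
    (g : Fin k → CMIdx m) :
    cmMinor rsq ρsq (List.ofFn g) (List.ofFn g) = 0 ↔
      ∃ v : Fin k → ℂ, v ≠ 0 ∧ ∀ i, ∑ j, (cmEnt rsq ρsq (g i) (g j) : ℂ) * v j = 0 := by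
  rw [cmMinor_ofFn]
  set M : Matrix (Fin k) (Fin k) ℝ := Matrix.of fun i j : Fin k => cmEnt rsq ρsq (g i) (g j)
    with hM
  have h1 : M.det = 0 ↔ (M.map (Complex.ofRealHom)).det = 0 := by
    have := (RingHom.map_det Complex.ofRealHom M)
    rw [RingHom.mapMatrix_apply] at this
    rw [← this]
    simp
  rw [h1, ← Matrix.exists_mulVec_eq_zero_iff]
  constructor
  · rintro ⟨v, hv, h⟩
    exact ⟨v, hv, fun i => by simpa [Matrix.mulVec, dotProduct, hM] using congrFun h i⟩
  · rintro ⟨v, hv, h⟩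
    exact ⟨v, hv, funext fun i => by simpa [Matrix.mulVec, dotProduct, hM] using h i⟩

theorem cmEnt_pt_pt {n m : ℕ} (α : Fin m → Fin n → ℝ) (rsq : Fin m → ℝ) (j k : Fin m) :
    cmEnt rsq (sphereRhosq α) (CMIdx.pt j) (CMIdx.pt k) = ∑ ν, (α j ν - α k ν) ^ 2 := by
  by_cases h : j = k
  · subst h; simp [cmEnt]
  · simp [cmEnt, h, sphereRhosq]

/-- Expansion of the weighted sum of squared distances. -/
theorem sum_dist_expand {n N : ℕ} (a : Fin N → Fin n → ℂ) (c : Fin N → ℂ) (b : Fin n → ℂ) :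
    ∑ j, (∑ ν, (b ν - a j ν) ^ 2) * c j
      = (∑ ν, b ν ^ 2) * (∑ j, c j) + ∑ j, c j * (∑ ν, a j ν ^ 2)
        - 2 * ∑ ν, b ν * ∑ j, c j * a j ν := by
  have h : ∑ ν, b ν * ∑ j, c j * a j ν = ∑ j, c j * ∑ ν, b ν * a j ν := by
    simp only [Finset.mul_sum]
    rw [Finset.sum_comm]
    exact Finset.sum_congr rfl fun _ _ => Finset.sum_congr rfl fun _ _ => by ring
  rw [h, Finset.mul_sum, Finset.mul_sum, ← Finset.sum_add_distrib, ← Finset.sum_sub_distrib]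
  refine Finset.sum_congr rfl fun j _ => ?_
  have : ∑ ν, (b ν - a j ν) ^ 2
      = ∑ ν, b ν ^ 2 + ∑ ν, a j ν ^ 2 - 2 * ∑ ν, b ν * a j ν := by
    rw [Finset.mul_sum, ← Finset.sum_add_distrib, ← Finset.sum_sub_distrib]
    exact Finset.sum_congr rfl fun _ _ => by ring
  rw [this]; ring

theorem cm0_zero_iff {n m N : ℕ} (α : Fin m → Fin n → ℝ) (rsq : Fin m → ℝ) (J : Fin N → Fin m) :
    cmMinor rsq (sphereRhosq α)
        (CMIdx.zero :: List.ofFn fun i => CMIdx.pt (J i))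
        (CMIdx.zero :: List.ofFn fun i => CMIdx.pt (J i)) = 0 ↔
    ∃ (u : ℂ) (c : Fin N → ℂ), (u ≠ 0 ∨ c ≠ 0) ∧ ∑ j, c j = 0 ∧
      ∀ i, u + ∑ j, (∑ ν, ((α (J i) ν : ℂ) - α (J j) ν) ^ 2) * c j = 0 := by
  have e : (CMIdx.zero :: List.ofFn fun i => CMIdx.pt (J i))
    = List.ofFn (Fin.cons CMIdx.zero (fun i => CMIdx.pt (J i)) : Fin (N+1) → CMIdx m) := by
    simp [List.ofFn_succ]
  rw [e, cmMinor_zero_iff]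
  simp only [Fin.forall_fin_succ, Fin.sum_univ_succ, Fin.cons_zero, Fin.cons_succ, cmEnt_pt_pt]
  simp only [cmEnt]
  push_cast
  constructor
  · rintro ⟨v, hv, h1, h2⟩
    refine ⟨v 0, fun i => v i.succ, ?_, by simpa using h1, fun i => by simpa using h2 i⟩
    by_contra! hc
    exact hv (funext fun i => Fin.cases hc.1 (fun i => congrFun hc.2 i) i)
  · rintro ⟨u, c, hne, h1, h2⟩
    refine ⟨Fin.cons u c, ?_, by simpa using h1, fun i => by simpa using h2 i⟩
    intro h
    rcases hne with hu | hc
    · exact hu (by simpa using congrFun h 0)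
    · exact hc (funext fun i => by simpa using congrFun h i.succ)

theorem cmstar_zero_iff {n m N : ℕ} (α : Fin m → Fin n → ℝ) (rsq : Fin m → ℝ)
    (J : Fin N → Fin m) :
    cmMinor rsq (sphereRhosq α)
        (CMIdx.zero :: CMIdx.star :: List.ofFn fun i => CMIdx.pt (J i))
        (CMIdx.zero :: CMIdx.star :: List.ofFn fun i => CMIdx.pt (J i)) = 0 ↔
    ∃ (u w : ℂ) (c : Fin N → ℂ), (u ≠ 0 ∨ w ≠ 0 ∨ c ≠ 0) ∧ w + ∑ j, c j = 0 ∧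
      u + ∑ j, (rsq (J j) : ℂ) * c j = 0 ∧
      ∀ i, u + (rsq (J i) * w + ∑ j, (∑ ν, ((α (J i) ν : ℂ) - α (J j) ν) ^ 2) * c j) = 0 := by
  have e : (CMIdx.zero :: CMIdx.star :: List.ofFn fun i => CMIdx.pt (J i))
    = List.ofFn (Fin.cons CMIdx.zero (Fin.cons CMIdx.star (fun i => CMIdx.pt (J i)) :
        Fin (N+1) → CMIdx m) : Fin (N+2) → CMIdx m) := by
    simp [List.ofFn_succ]
  rw [e, cmMinor_zero_iff]
  simp only [Fin.forall_fin_succ (n := N+1), Fin.forall_fin_succ (n := N),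
    Fin.sum_univ_succ (n := N+1), Fin.sum_univ_succ (n := N),
    Fin.cons_zero, Fin.cons_succ, cmEnt_pt_pt]
  simp only [cmEnt]
  push_cast
  constructor
  · rintro ⟨v, hv, h1, h2, h3⟩
    refine ⟨v 0, v (Fin.succ 0), fun i => v i.succ.succ, ?_, by simpa using h1,
      by simpa using h2, fun i => by simpa using h3 i⟩
    by_contra! hc
    exact hv (funext fun i => Fin.cases hc.1
      (fun i => Fin.cases hc.2.1 (fun i => congrFun hc.2.2 i) i) i)
  · rintro ⟨u, w, c, hne, h1, h2, h3⟩
    refine ⟨Fin.cons u (Fin.cons w c : Fin (N+1) → ℂ), ?_, by simpa using h1,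
      by simpa using h2, fun i => by simpa using h3 i⟩
    intro h
    rcases hne with hu | hw | hc
    · exact hu (by simpa using congrFun h 0)
    · exact hw (by simpa using congrFun h (Fin.succ 0))
    · exact hc (funext fun i => by simpa using congrFun h i.succ.succ)

theorem dot_comb {n N : ℕ} (a : Fin N → Fin n → ℂ) (c : Fin N → ℂ) (x : Fin n → ℂ) :
    ∑ i, c i * ∑ ν, a i ν * x ν = ∑ ν, (∑ i, c i * a i ν) * x ν := by
  simp only [Finset.mul_sum, Finset.sum_mul]
  rw [Finset.sum_comm]
  exact Finset.sum_congr rfl fun _ _ => Finset.sum_congr rfl fun _ _ => by ring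

/-- For `n+1` spheres in general position of centers (`B(0J) ≠ 0`), the complex
hyperspheres `S_j (j ∈ J)` have a common point iff `B(0⋆J) = 0`. -/
theorem spheres_common_point_iff_cm_star_eq_zero
    (n m : ℕ) (α : Fin m → Fin n → ℝ) (α0 : Fin m → ℝ)
    (J : Fin (n + 1) → Fin m) (hJ : Function.Injective J)
    (h0J : cmMinor (sphereRsq α α0) (sphereRhosq α)
        (CMIdx.zero :: List.ofFn fun i => CMIdx.pt (J i))
        (CMIdx.zero :: List.ofFn fun i => CMIdx.pt (J i)) ≠ 0) :
    (∃ x : Fin n → ℂ, ∀ i : Fin (n + 1), sphereFun α α0 (J i) x = 0) ↔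
      cmMinor (sphereRsq α α0) (sphereRhosq α)
        (CMIdx.zero :: CMIdx.star :: List.ofFn fun i => CMIdx.pt (J i))
        (CMIdx.zero :: CMIdx.star :: List.ofFn fun i => CMIdx.pt (J i)) = 0 := by
  rw [Ne, cm0_zero_iff] at h0J
  rw [cmstar_zero_iff]
  simp only [sum_dist_expand (fun j ν => ((α (J j) ν : ℝ) : ℂ))] at h0J ⊢
  obtain ⟨a, ha⟩ : ∃ a : Fin (n + 1) → Fin n → ℂ, ∀ j ν, ((α (J j) ν : ℝ) : ℂ) = a j ν :=
    ⟨_, fun _ _ => rfl⟩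
  simp only [ha] at h0J ⊢
  have hr : ∀ i, ((sphereRsq α α0 (J i) : ℝ) : ℂ) = ∑ ν, a i ν ^ 2 - α0 (J i) := by
    intro i; simp [sphereRsq, ha]
  have hf : ∀ i x, sphereFun α α0 (J i) x
      = (∑ ν, x ν ^ 2) + 2 * (∑ ν, a i ν * x ν) + (α0 (J i) : ℂ) := fun i x => by
    simp [sphereFun, ha]
  simp only [hr, hf]
  constructor
  · rintro ⟨x, hx⟩
    let T : (Fin (n + 1) → ℂ) →ₗ[ℂ] ℂ × (Fin n → ℂ) :=
      { toFun := fun c => (∑ j, c j, fun ν => ∑ j, c j * a j ν)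
        map_add' := fun c d => by
          ext <;> simp [add_mul, Finset.sum_add_distrib]
        map_smul' := fun t c => by
          ext <;> simp [mul_assoc, Finset.mul_sum] }
    have hinj : Function.Injective T := by
      rw [injective_iff_map_eq_zero]
      intro c hc
      by_contra hne
      have hc1 : ∑ j, c j = 0 := congrArg Prod.fst hc
      have hc2 : ∀ ν, ∑ j, c j * a j ν = 0 := fun ν => congrFun (congrArg Prod.snd hc) ν
      refine h0J ⟨-∑ j, c j * ∑ ν, a j ν ^ 2, c, Or.inr hne, hc1, fun i => ?_⟩
      simp only [hc1, hc2]
      simp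
    have hsurj : Function.Surjective T :=
      (LinearMap.injective_iff_surjective_of_finrank_eq_finrank (by simp [add_comm])).1 hinj
    obtain ⟨c, hc⟩ := hsurj (-1, x)
    have hc1 : ∑ j, c j = -1 := congrArg Prod.fst hc
    have hc2 : ∀ ν, ∑ j, c j * a j ν = x ν := fun ν => congrFun (congrArg Prod.snd hc) ν
    refine ⟨-(∑ ν, x ν ^ 2) - ∑ j, c j * ∑ ν, a j ν ^ 2, 1, c, Or.inr (Or.inl one_ne_zero),
      by rw [hc1]; ring, ?_, fun i => ?_⟩
    · have hs : ∑ j, c j * ((∑ ν, x ν ^ 2) + 2 * (∑ ν, a j ν * x ν) + (α0 (J j) : ℂ)) = 0 :=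
        Finset.sum_eq_zero fun j _ => by rw [hx j, mul_zero]
      have hs2 : ∑ j, c j * ((∑ ν, x ν ^ 2) + 2 * (∑ ν, a j ν * x ν) + (α0 (J j) : ℂ))
          = (∑ j, c j) * (∑ ν, x ν ^ 2) + 2 * (∑ j, c j * ∑ ν, a j ν * x ν)
            + ∑ j, c j * (α0 (J j) : ℂ) := by
        rw [Finset.sum_mul, Finset.mul_sum, ← Finset.sum_add_distrib, ← Finset.sum_add_distrib]
        exact Finset.sum_congr rfl fun _ _ => by ring
      have hs3 : ∑ j, (∑ ν, a j ν ^ 2 - (α0 (J j) : ℂ)) * c j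
          = ∑ j, c j * ∑ ν, a j ν ^ 2 - ∑ j, c j * (α0 (J j) : ℂ) := by
        rw [← Finset.sum_sub_distrib]
        exact Finset.sum_congr rfl fun _ _ => by ring
      have hs4 : ∑ ν, x ν * x ν = ∑ ν, x ν ^ 2 := Finset.sum_congr rfl fun _ _ => by ring
      rw [hs2, dot_comb, hc1] at hs
      simp only [hc2, hs4] at hs
      rw [hs3]
      linear_combination -hs
    · have := hx i
      simp only [hc1, hc2]
      linear_combination -this
  · rintro ⟨u, w, c, hne, h1, h2, h3⟩
    have hw : w ≠ 0 := by
      rintro rfl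
      refine h0J ⟨u, c, by simpa using hne, by simpa using h1, fun i => ?_⟩
      have := h3 i
      rw [mul_zero, zero_add] at this
      exact this
    set v : Fin n → ℂ := fun ν => ∑ j, c j * a j ν with hv
    set S : ℂ := ∑ j, c j * ∑ ν, a j ν ^ 2 with hS
    have hc : ∑ j, c j = -w := by linear_combination h1
    have h4 : ∀ i, u + S - w * α0 (J i) - 2 * ∑ ν, a i ν * v ν = 0 := by
      intro i
      have := h3 i
      rw [hc] at this
      linear_combination this
    have hs3 : ∑ j, (∑ ν, a j ν ^ 2 - (α0 (J j) : ℂ)) * c j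
          = S - ∑ j, c j * (α0 (J j) : ℂ) := by
      rw [hS, ← Finset.sum_sub_distrib]
      exact Finset.sum_congr rfl fun _ _ => by ring
    have hs : ∑ i, c i * (u + S - w * α0 (J i) - 2 * ∑ ν, a i ν * v ν) = 0 :=
      Finset.sum_eq_zero fun j _ => by rw [h4 j, mul_zero]
    have hs2 : ∑ i, c i * (u + S - w * α0 (J i) - 2 * ∑ ν, a i ν * v ν)
        = (∑ j, c j) * (u + S) - w * (∑ j, c j * (α0 (J j) : ℂ))
          - 2 * ∑ i, c i * ∑ ν, a i ν * v ν := by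
      rw [Finset.sum_mul, Finset.mul_sum, Finset.mul_sum, ← Finset.sum_sub_distrib,
        ← Finset.sum_sub_distrib]
      exact Finset.sum_congr rfl fun _ _ => by ring
    have hs4 : ∑ ν, (∑ i, c i * a i ν) * v ν = ∑ ν, v ν ^ 2 :=
      Finset.sum_congr rfl fun _ _ => by rw [hv]; ring
    rw [hs2, dot_comb, hc, hs4] at hs
    rw [hs3] at h2
    have hQ : ∑ ν, v ν ^ 2 = -w * (u + S) := by
      linear_combination (-1/2) * hs + (w/2) * h2
    refine ⟨fun ν => v ν / w, fun i => ?_⟩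
    have e1 : ∑ ν, (v ν / w) ^ 2 = (∑ ν, v ν ^ 2) / w ^ 2 := by
      rw [Finset.sum_div]; exact Finset.sum_congr rfl fun _ _ => by ring
    have e2 : ∑ ν, a i ν * (v ν / w) = (∑ ν, a i ν * v ν) / w := by
      rw [Finset.sum_div]; exact Finset.sum_congr rfl fun _ _ => by ring
    rw [e1, e2, hQ]
    have := h4 i
    field_simp
    linear_combination -this
end

section
/- Assume the quadrics are in normalized form: f_{n+1}(x) = Q(x) + α_{n+1,0} and f_j(x) = Q(x) + 2 Σ_{ν=1}^{n+1−j} α_{jν} x_ν + α_{j0} for 1 ≤ j ≤ n, with all α_{jν}, α_{j0} real. For x ∈ ℝ^n and 1 ≤ ν ≤ n+1, let M_ν(x) be the n×n matrix whose rows are the gradients ∇f_μ(x) for μ ∈ {1, …, n+1} ∖ {ν}, taken in increasing order of μ. Then for each p with 1 ≤ p ≤ n and all x ∈ ℝ^n: Σ_{ν=1}^{p} (−1)^{ν−1} α_{ν, n−p+1} · det M_ν(x) = 2^n (−1)^{n(n+1)/2 + 1} · x_{n−p+1} · ∏_{μ=1}^{n} α_{n−μ+1, μ}. -/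
theorem sign_revPerm_aux (n : ℕ) :
    Equiv.Perm.sign (Fin.revPerm : Equiv.Perm (Fin (n + 1))) = (-1) ^ (n * (n + 1) / 2) := by
  rw [Equiv.Perm.sign_eq_prod_prod_Iio]
  have h : ∀ j : Fin (n + 1), (∏ i ∈ Finset.Iio j,
      (if Fin.revPerm i < Fin.revPerm j then (1 : ℤˣ) else -1)) = (-1) ^ (j : ℕ) := by
    intro j
    rw [Finset.prod_congr rfl (g := fun _ => (-1 : ℤˣ))]
    · simp
    · intro i hi
      rw [if_neg]
      simp only [Fin.revPerm_apply, Fin.rev_lt_rev, not_lt]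
      exact (Finset.mem_Iio.mp hi).le
  rw [Finset.prod_congr rfl fun j _ => h j, Finset.prod_pow_eq_pow_sum,
    Fin.sum_univ_eq_sum_range (fun i => i) (n + 1), Finset.sum_range_id]
  congr 2
  rw [Nat.add_sub_cancel, Nat.mul_comm]

/-- The determinant of the bordered matrix `[1 | α]`. -/
theorem det_bordered (n : ℕ) (α : Fin (n + 1) → Fin n → ℝ)
    (hα : ∀ (j : Fin (n + 1)) (ν : Fin n), n ≤ (j : ℕ) + (ν : ℕ) → α j ν = 0) :
    Matrix.det (Matrix.of fun i j : Fin (n + 1) =>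
      (Fin.cons 1 (α i) : Fin (n + 1) → ℝ) j) =
      (-1 : ℝ) ^ (n * (n + 1) / 2) * ∏ μ : Fin n, α (Fin.castSucc μ.rev) μ := by
  set A : Matrix (Fin (n + 1)) (Fin (n + 1)) ℝ := Matrix.of fun i j : Fin (n + 1) =>
      (Fin.cons 1 (α i) : Fin (n + 1) → ℝ) j with hA
  have h1 := Matrix.det_permute Fin.revPerm A
  have h2 : (A.submatrix Fin.revPerm id).det = ∏ μ : Fin n, α (Fin.castSucc μ.rev) μ := by
    rw [Matrix.det_of_lowerTriangular, Fin.prod_univ_succ]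
    · simp [hA, Fin.rev_succ]
    · intro i j hij
      have hij' : i < j := hij
      obtain ⟨k, rfl⟩ := Fin.exists_succ_eq.mpr (Fin.ne_zero_of_lt hij')
      simp only [hA, Matrix.submatrix_apply, Matrix.of_apply, id, Fin.cons_succ,
        Fin.revPerm_apply]
      apply hα
      rw [Fin.lt_def, Fin.val_succ] at hij'
      rw [Fin.val_rev]
      omega
  rw [h2, sign_revPerm_aux] at h1
  rw [h1]
  push_cast
  rw [← mul_assoc, ← mul_pow]
  simp

/-- Passing from `[1 | 2x + 2α]` to `[1 | α]`. -/
theorem det_bordered_shift (n : ℕ) (α : Fin (n + 1) → Fin n → ℝ) (x : Fin n → ℝ) :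
    Matrix.det (Matrix.of fun i j : Fin (n + 1) =>
      (Fin.cons 1 (fun b => 2 * x b + 2 * α i b) : Fin (n + 1) → ℝ) j) =
    2 ^ n * Matrix.det (Matrix.of fun i j : Fin (n + 1) =>
      (Fin.cons 1 (α i) : Fin (n + 1) → ℝ) j) := by
  let U : Matrix (Fin (n + 1)) (Fin (n + 1)) ℝ := Matrix.of fun i =>
    (Fin.cons (Fin.cons 1 fun b => 2 * x b)
      (fun a => Fin.cons 0 fun b => if a = b then 2 else 0) :
      Fin (n + 1) → Fin (n + 1) → ℝ) i
  have hU : U.det = 2 ^ n := by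
    rw [Matrix.det_of_upperTriangular, Fin.prod_univ_succ]
    · simp [U]
    · intro i j hij
      have hij' : j < i := hij
      obtain ⟨k, rfl⟩ := Fin.exists_succ_eq.mpr (Fin.ne_zero_of_lt hij')
      clear hij
      revert hij'
      refine Fin.cases ?_ (fun b => ?_) j
      · intro _; simp [U]
      · intro hb
        have : k ≠ b := fun h => by subst h; exact lt_irrefl _ hb
        simp [U, this]
  rw [← hU, mul_comm, ← Matrix.det_mul]
  congr 1
  ext i j
  rw [Matrix.mul_apply, Fin.sum_univ_succ]
  refine Fin.cases ?_ (fun b => ?_) j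
  · simp [U]
  · simp [U, mul_comm]

/-- The bordered determinant with first column `α_{·,q}`. -/
theorem det_bordered_col (n : ℕ) (α : Fin (n + 1) → Fin n → ℝ) (x : Fin n → ℝ) (q : Fin n) :
    Matrix.det (Matrix.of fun i j : Fin (n + 1) =>
      (Fin.cons (α i q) (fun b => 2 * x b + 2 * α i b) : Fin (n + 1) → ℝ) j) =
    -x q * Matrix.det (Matrix.of fun i j : Fin (n + 1) =>
      (Fin.cons 1 (fun b => 2 * x b + 2 * α i b) : Fin (n + 1) → ℝ) j) := by
  rw [← Matrix.det_updateCol_add_smul_self _ (Fin.succ_ne_zero q).symm (-1 / 2 : ℝ)]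
  set B : Matrix (Fin (n + 1)) (Fin (n + 1)) ℝ := Matrix.of fun i j : Fin (n + 1) =>
      (Fin.cons 1 (fun b => 2 * x b + 2 * α i b) : Fin (n + 1) → ℝ) j with hB
  have h := Matrix.det_updateCol_smul B 0 (-x q) (fun _ => 1)
  have h' : B.updateCol 0 (fun _ => 1) = B := by
    ext i j
    refine Fin.cases ?_ (fun b => ?_) j <;> simp [hB]
  rw [h'] at h
  rw [← h]
  congr 1
  ext i j
  refine Fin.cases ?_ (fun b => ?_) j
  · simp; ring
  · simp [hB]


/-- In normalized form (`α_{jν} = 0` for `ν > n+1−j`), for `1 ≤ p ≤ n` and all `x ∈ ℝⁿ`: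
`Σ_{ν=1}^{p} (−1)^{ν−1} α_{ν,n−p+1} · det M_ν(x)
  = 2^n (−1)^{n(n+1)/2+1} x_{n−p+1} ∏_{μ=1}^{n} α_{n−μ+1,μ}`,
where `M_ν(x)` is the `n×n` matrix whose rows are the gradients `∇f_μ(x)`,
`μ ∈ {1,…,n+1} ∖ {ν}` in increasing order, with `(∇f_j(x))_ν = 2x_ν + 2α_{jν}`.
(Indices are 1-based in the informal statement; here `j ∈ Fin (n+1)` stands for `j+1`
and `ν ∈ Fin n` for `ν+1`.) -/
theorem gradient_minor_sum_eq (n : ℕ) (α : Fin (n + 1) → Fin n → ℝ)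
    (hα : ∀ (j : Fin (n + 1)) (ν : Fin n), n ≤ (j : ℕ) + (ν : ℕ) → α j ν = 0)
    (p : ℕ) (hp1 : 1 ≤ p) (hpn : p ≤ n) (x : Fin n → ℝ) :
    (∑ i : Fin p,
      (-1 : ℝ) ^ (i : ℕ) * α (Fin.castLE (by omega) i) ⟨n - p, by omega⟩ *
        Matrix.det (Matrix.of fun a b : Fin n =>
          2 * x b + 2 * α ((Fin.castLE (by omega) i : Fin (n + 1)).succAbove a) b)) =
      2 ^ n * (-1 : ℝ) ^ (n * (n + 1) / 2 + 1) * x ⟨n - p, by omega⟩ *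
        ∏ μ : Fin n, α (Fin.castSucc μ.rev) μ := by
  have key := det_bordered_col n α x ⟨n - p, by omega⟩
  rw [det_bordered_shift, det_bordered n α hα, Matrix.det_succ_column_zero] at key
  have e : n + 1 = p + (n + 1 - p) := by omega
  rw [pow_succ]
  trans ∑ i : Fin (n + 1), (-1 : ℝ) ^ (i : ℕ) * α i ⟨n - p, by omega⟩ *
        Matrix.det (Matrix.of fun a b : Fin n => 2 * x b + 2 * α (i.succAbove a) b)
  · refine Finset.sum_of_injOn (Fin.castLE (by omega)) ?_ ?_ ?_ ?_
    · exact (Fin.castLE_injective _).injOn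
    · intro i _; simp
    · intro i _ hi
      have : p ≤ (i : ℕ) := by
        by_contra hlt
        exact hi ⟨⟨i, by omega⟩, by simp, by ext; simp⟩
      rw [hα i _ (by simp only []; omega)]
      simp
    · intro i _
      simp
  · refine Eq.trans ?_ (key.trans (by ring))
    refine Finset.sum_congr rfl fun i _ => ?_
    congr 1
end

section
/- Assume the quadrics are in normalized form: f_{n+1}(x) = Q(x) + α_{n+1,0} and f_j(x) = Q(x) + 2 Σ_{ν=1}^{n+1−j} α_{jν} x_ν + α_{j0} for 1 ≤ j ≤ n, and write f̄_j = f_j − α_{j0}. Then for each p with 1 ≤ p ≤ n and all x ∈ ℝ^n: (f̄_p(x) − f̄_{n+1}(x)) · ∏_{ν=1}^{n−p} α_{n−ν+1,ν} = 2 x_{n−p+1} · ∏_{ν=1}^{n−p+1} α_{n−ν+1,ν} + (−1)^{(n−p)(n−p−1)/2} Σ_{μ=p+1}^{n} (−1)^{μ−p−1} (f̄_μ(x) − f̄_{n+1}(x)) · 𝛂(p, p+1, …, μ̂, …, n ; 1, 2, …, n−p), where μ̂ means that the row index μ is omitted. -/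
/-- The homogeneous part of the normalized quadric: `f̄_j(x) = Q(x) + 2 Σ_ν α_{jν} x_ν`. -/
def fbar {n : ℕ} (α : Fin (n + 1) → Fin n → ℝ) (j : Fin (n + 1)) (x : Fin n → ℝ) : ℝ :=
  (∑ ν, x ν ^ 2) + 2 * ∑ ν, α j ν * x ν

/-- Determinant of an anti-triangular matrix. -/
theorem det_antitri (m : ℕ) : ∀ (A : ℕ → ℕ → ℝ),
    (∀ i j, i < m → j < m → m ≤ i + j → A i j = 0) →
    Matrix.det (Matrix.of fun i j : Fin m => A i j) =
      (-1 : ℝ) ^ (m * (m - 1) / 2) * ∏ ν : Fin m, A (m - 1 - (ν : ℕ)) ν := by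
  induction m with
  | zero => intro A _; simp
  | succ m ih =>
    intro A h
    rw [Matrix.det_succ_column _ (Fin.last m), Fin.sum_univ_succ, Finset.sum_eq_zero]
    · have h1 : ((Matrix.of fun i j : Fin (m + 1) => A i j).submatrix
          (Fin.succAbove 0) (Fin.last m).succAbove) =
          Matrix.of fun i j : Fin m => (fun a b => A (a + 1) b) i j := by
        ext i j; simp
      rw [h1, ih (fun a b => A (a + 1) b)
        (fun i j hi hj hij => h _ _ (by omega) (by omega) (by omega)), Fin.prod_univ_castSucc]
      have h2 : (m + 1) * (m + 1 - 1) / 2 = m + m * (m - 1) / 2 := by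
        rcases m with _ | k
        · rfl
        · have : (k + 1 + 1) * (k + 1 + 1 - 1) = (k + 1) * (k + 1 - 1) + (k + 1) * 2 := by
            simp only [Nat.add_sub_cancel]; ring
          rw [this, Nat.add_mul_div_right _ _ (by norm_num)]; ring
      have h3 : ∀ ν : Fin m, A (m - 1 - (ν : ℕ) + 1) ν =
          A (m + 1 - 1 - ((Fin.castSucc ν : Fin (m+1)) : ℕ)) ((Fin.castSucc ν : Fin (m+1)) : ℕ) := by
        intro ν
        have : m - 1 - (ν : ℕ) + 1 = m + 1 - 1 - (ν : ℕ) := by omega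
        rw [this]; rfl
      rw [h2, pow_add]
      simp only [h3]
      simp
      ring
    · intro i _
      have : A ((i : ℕ) + 1) m = 0 := h _ _ (by omega) (by omega) (by omega)
      simp [this]

theorem core_nat (m : ℕ) (B : ℕ → ℕ → ℝ) (hB : ∀ i j, i ≤ m → j ≤ m → m < i + j → B i j = 0)
    (y : Fin (m + 1) → ℝ) (g : ℕ → ℝ) (hg : ∀ i : Fin (m + 1), g i = ∑ j, y j * B i j) :
    g 0 * ∏ ν : Fin m, B (m - (ν : ℕ)) ν =
      y (Fin.last m) * ∏ ν : Fin (m + 1), B (m - (ν : ℕ)) ν +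
      (-1 : ℝ) ^ (m * (m - 1) / 2) * ∑ k : Fin m, (-1 : ℝ) ^ (k : ℕ) * g (k + 1) *
        Matrix.det (Matrix.of fun a b : Fin m => B ((Fin.succAbove (Fin.succ k) a : Fin (m+1)) : ℕ) b) := by
  have key := Matrix.det_updateCol_sum (Matrix.of fun i j : Fin (m + 1) => B i j) (Fin.last m) y
  have e : (fun k : Fin (m+1) => ∑ i, y i • (Matrix.of fun i j : Fin (m + 1) => B i j) k i) =
      fun k : Fin (m + 1) => g k := by
    ext k; rw [hg]; simp
  rw [e, det_antitri (m + 1) B (fun i j hi hj hij => hB _ _ (by omega) (by omega) (by omega)),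
    Matrix.det_succ_column _ (Fin.last m), Fin.sum_univ_succ] at key
  have sub : ∀ i : Fin (m + 1), ((Matrix.of fun i j : Fin (m + 1) => B i j).updateCol (Fin.last m)
      (fun k : Fin (m + 1) => g k)).submatrix i.succAbove (Fin.last m).succAbove =
      Matrix.of fun a b : Fin m => B ((i.succAbove a : Fin (m+1)) : ℕ) b := by
    intro i; ext a b
    simp [Matrix.updateCol_apply, Fin.ext_iff, b.2.ne]
  have h0 : (Matrix.of fun a b : Fin m => B (((0 : Fin (m+1)).succAbove a : Fin (m+1)) : ℕ) b).det =
      (-1 : ℝ) ^ (m * (m - 1) / 2) * ∏ ν : Fin m, B (m - (ν : ℕ)) ν := by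
    have := det_antitri m (fun a b => B (a + 1) b)
      (fun i j hi hj hij => hB _ _ (by omega) (by omega) (by omega))
    have h3 : ∀ ν : Fin m, B (m - 1 - (ν : ℕ) + 1) ν = B (m - (ν : ℕ)) ν := by
      intro ν
      congr 1; omega
    simp only [h3] at this
    rw [← this]
    simp
  have h2 : (m + 1) * (m + 1 - 1) / 2 = m + m * (m - 1) / 2 := by
    rcases m with _ | k
    · rfl
    · have : (k + 1 + 1) * (k + 1 + 1 - 1) = (k + 1) * (k + 1 - 1) + (k + 1) * 2 := by
        simp only [Nat.add_sub_cancel]; ring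
      rw [this, Nat.add_mul_div_right _ _ (by norm_num)]; ring
  rw [h2] at key
  simp only [sub, h0, Matrix.updateCol_self, pow_add, Fin.val_succ, Fin.val_zero, Fin.val_last,
    pow_zero, one_mul, pow_one, smul_eq_mul, Nat.add_sub_cancel] at key
  set S : ℝ := ∑ k : Fin m, (-1 : ℝ) ^ (k : ℕ) * g (k + 1) *
        Matrix.det (Matrix.of fun a b : Fin m => B ((Fin.succAbove (Fin.succ k) a : Fin (m+1)) : ℕ) b) with hS
  have hsum : (∑ k : Fin m, (-1 : ℝ) ^ (k : ℕ) * -1 * (-1) ^ m * g (k + 1) *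
        Matrix.det (Matrix.of fun a b : Fin m => B ((Fin.succAbove (Fin.succ k) a : Fin (m+1)) : ℕ) b))
        = - (-1) ^ m * S := by
    rw [hS, Finset.mul_sum]
    exact Finset.sum_congr rfl fun k _ => by ring
  rw [hsum] at key
  have q1 : ((-1 : ℝ) ^ m) * (-1) ^ m = 1 := by rw [← mul_pow]; norm_num
  have q2 : ((-1 : ℝ) ^ (m * (m - 1) / 2)) * (-1) ^ (m * (m - 1) / 2) = 1 := by
    rw [← mul_pow]; norm_num
  generalize (-1 : ℝ) ^ m = s at *
  generalize (-1 : ℝ) ^ (m * (m - 1) / 2) = t at *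
  generalize (∏ ν : Fin m, B (m - (ν : ℕ)) ν) = P at *
  generalize (∏ ν : Fin (m + 1), B (m - (ν : ℕ)) ν) = P' at *
  linear_combination (s * t) * key - (g 0 * P - y (Fin.last m) * P') * (q1 * t * t + q2) + t * S * q1

theorem core_fin (n : ℕ) (α : Fin (n + 1) → Fin n → ℝ)
    (hα : ∀ (j : Fin (n + 1)) (ν : Fin n), n ≤ (j : ℕ) + (ν : ℕ) → α j ν = 0)
    (p : ℕ) (hp1 : 1 ≤ p) (m : ℕ) (hm : n = p + m) (x : Fin n → ℝ) :
    (fbar α ⟨p - 1, by omega⟩ x - fbar α ⟨n, by omega⟩ x) *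
        (∏ ν : Fin m, α ⟨n - 1 - (ν : ℕ), by omega⟩ ⟨(ν : ℕ), by omega⟩) =
      2 * x ⟨m, by omega⟩ *
          (∏ ν : Fin (m + 1), α ⟨n - 1 - (ν : ℕ), by omega⟩ ⟨(ν : ℕ), by omega⟩) +
        (-1 : ℝ) ^ (m * (m - 1) / 2) *
          ∑ k : Fin m,
            (-1 : ℝ) ^ (k : ℕ) * (fbar α ⟨p + (k : ℕ), by omega⟩ x - fbar α ⟨n, by omega⟩ x) *
              Matrix.det (Matrix.of fun a b : Fin m =>
                α ⟨p - 1 +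
                      ((((⟨(k : ℕ) + 1, by omega⟩ : Fin (m + 1)).succAbove a) : ℕ)),
                    by omega⟩
                  ⟨(b : ℕ), by omega⟩) := by
  obtain ⟨q, rfl⟩ : ∃ q, p = q + 1 := ⟨p - 1, by omega⟩
  let A : ℕ → ℕ → ℝ := fun i j => if h : i < n + 1 ∧ j < n then α ⟨i, h.1⟩ ⟨j, h.2⟩ else 0
  let X : ℕ → ℝ := fun j => if h : j < n then x ⟨j, h⟩ else 0
  have hA : ∀ i j (hi : i < n + 1) (hj : j < n), α ⟨i, hi⟩ ⟨j, hj⟩ = A i j := by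
    intro i j hi hj; simp only [A, dif_pos (And.intro hi hj)]
  have hX : ∀ j (hj : j < n), x ⟨j, hj⟩ = X j := by
    intro j hj; simp [X, hj]
  have hA0 : ∀ i j, n ≤ i + j → A i j = 0 := by
    intro i j hij
    by_cases h : i < n + 1 ∧ j < n
    · rw [← hA i j h.1 h.2]; exact hα _ _ hij
    · simp only [A, dif_neg h]
  have hf : ∀ i (hi : i < n + 1), fbar α ⟨i, hi⟩ x - fbar α ⟨n, by omega⟩ x =
      ∑ j ∈ Finset.range n, 2 * X j * A i j := by
    intro i hi
    have hz : ∀ ν : Fin n, α ⟨n, by omega⟩ ν = 0 := fun ν => hα _ _ (by simp)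
    rw [Finset.sum_range]
    simp only [fbar, hz, zero_mul, Finset.sum_const_zero, mul_zero, add_zero, add_sub_cancel_left,
      Finset.mul_sum]
    refine Finset.sum_congr rfl fun ν _ => ?_
    rw [← hA i ν hi ν.2, ← hX ν ν.2]; ring
  have main := core_nat m (fun i j => A (q + i) j)
    (fun i j hi hj hij => hA0 _ _ (by omega)) (fun j => 2 * X j)
    (fun i => ∑ j ∈ Finset.range n, 2 * X j * A (q + i) j) (by
      intro i
      rw [← Finset.sum_range (fun j => 2 * X j * A (q + i) j)]
      symm
      apply Finset.sum_subset
      · intro j; simp only [Finset.mem_range]; omega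
      · intro j _ hj
        simp only [Finset.mem_range] at hj
        rw [hA0 _ _ (by omega), mul_zero])
  simp only [hf, hA, hX]
  have e1 : ∀ ν : ℕ, n - 1 - ν = q + m - ν := fun ν => by omega
  have e2 : ∀ (l : ℕ) (hl : l ≤ m + 1), (∏ ν : Fin l, A (n - 1 - (ν : ℕ)) ν) =
      ∏ ν : Fin l, A (q + (m - (ν : ℕ))) ν := by
    intro l hl
    refine Finset.prod_congr rfl fun ν _ => ?_
    congr 1; omega
  have e3 : ∀ k : ℕ, q + 1 + k = q + (k + 1) := fun k => by omega
  rw [e2 m (by omega), e2 (m + 1) le_rfl]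
  simp only [e3, Nat.add_sub_cancel]
  exact main

/-- Lemma 18 of Aomoto–Machida: in normalized form (`α_{jν} = 0` for `ν > n+1−j`),
for `1 ≤ p ≤ n` and all `x ∈ ℝⁿ`:
`(f̄_p − f̄_{n+1}) ∏_{ν=1}^{n−p} α_{n−ν+1,ν}
 = 2 x_{n−p+1} ∏_{ν=1}^{n−p+1} α_{n−ν+1,ν}
   + (−1)^{(n−p)(n−p−1)/2} Σ_{μ=p+1}^{n} (−1)^{μ−p−1} (f̄_μ − f̄_{n+1})
       𝛂(p, p+1, …, μ̂, …, n ; 1, …, n−p)`.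
(1-based indices `j`, `ν` are represented by `j−1 ∈ Fin (n+1)`, `ν−1 ∈ Fin n`.) -/
theorem fbar_difference_expansion (n : ℕ) (α : Fin (n + 1) → Fin n → ℝ)
    (hα : ∀ (j : Fin (n + 1)) (ν : Fin n), n ≤ (j : ℕ) + (ν : ℕ) → α j ν = 0)
    (p : ℕ) (hp1 : 1 ≤ p) (hpn : p ≤ n) (x : Fin n → ℝ) :
    (fbar α ⟨p - 1, by omega⟩ x - fbar α ⟨n, by omega⟩ x) *
        (∏ ν : Fin (n - p), α ⟨n - 1 - (ν : ℕ), by omega⟩ ⟨(ν : ℕ), by omega⟩) =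
      2 * x ⟨n - p, by omega⟩ *
          (∏ ν : Fin (n - p + 1), α ⟨n - 1 - (ν : ℕ), by omega⟩ ⟨(ν : ℕ), by omega⟩) +
        (-1 : ℝ) ^ ((n - p) * (n - p - 1) / 2) *
          ∑ k : Fin (n - p),
            (-1 : ℝ) ^ (k : ℕ) * (fbar α ⟨p + (k : ℕ), by omega⟩ x - fbar α ⟨n, by omega⟩ x) *
              Matrix.det (Matrix.of fun a b : Fin (n - p) =>
                α ⟨p - 1 +
                      ((((⟨(k : ℕ) + 1, by omega⟩ : Fin (n - p + 1)).succAbove a) : ℕ)),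
                    by omega⟩
                  ⟨(b : ℕ), by omega⟩) := by
  exact core_fin n α hα p hp1 (n - p) (by omega) x
end

section
/- Let J be a set of ν ≥ 2 indices from {1, …, m}, and assume B(0K) ≠ 0 for every subset K ⊆ J with |K| ≥ 3. Then (1/2) · Σ over all orderings (μ_0, μ_1, …, μ_{ν−1}) of J of the product ∏_{s=2}^{ν−1} [ B(0 ⋆ μ_{s−1} μ_{s−2} … μ_1 μ_0 ; 0 μ_s μ_{s−1} … μ_1 μ_0) / B(0 μ_s μ_{s−1} … μ_1 μ_0) ] = 1 (the empty product being 1). This is the identity η_J = 1 of Lemma 25. -/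
theorem cmh_list {m : ℕ} (rsq : Fin m → ℝ) (ρsq : Fin m → Fin m → ℝ) (n : ℕ)
    (r c : Fin n → CMIdx m) :
    cmMinor rsq ρsq (List.ofFn r) (List.ofFn c) =
      Matrix.det (Matrix.of fun i j : Fin n => cmEnt rsq ρsq (r i) (c j)) := by
  have h : (List.ofFn r).length = (List.ofFn c).length := by simp
  unfold cmMinor
  rw [dif_pos h, ← Matrix.det_submatrix_equiv_self (finCongr (List.length_ofFn (f := r)))]
  congr 1
  ext i j
  simp [Matrix.submatrix]
  rfl

/-- index map of the matrix attached to a finite set -/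
def cmhIdx {m q : ℕ} (g : Fin q → Fin m) (S : Finset (Fin q)) : Option S → CMIdx m
  | none => CMIdx.zero
  | some s => CMIdx.pt (g s)

noncomputable def cmhMat {m q : ℕ} (rsq : Fin m → ℝ) (ρsq : Fin m → Fin m → ℝ)
    (g : Fin q → Fin m) (S : Finset (Fin q)) : Matrix (Option S) (Option S) ℝ :=
  Matrix.of fun a b => cmEnt rsq ρsq (cmhIdx g S a) (cmhIdx g S b)

noncomputable def cmhNum {m q : ℕ} (rsq : Fin m → ℝ) (ρsq : Fin m → Fin m → ℝ)
    (g : Fin q → Fin m) (S : Finset (Fin q)) (j : Fin q) : Matrix (Option S) (Option S) ℝ :=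
  Matrix.of fun a b => cmEnt rsq ρsq
    (if a.map Subtype.val = some j then CMIdx.star else cmhIdx g S a) (cmhIdx g S b)

theorem cmh_cramer {S : Type*} [Fintype S] [DecidableEq S] (A : Matrix (Option S) (Option S) ℝ)
    (v : Option S → ℝ) (hv : v none = 1) (h0 : A none none = 0)
    (h1 : ∀ s, A (some s) none = 1) :
    ∑ s : S, (A.updateRow (some s) v).det = A.det := by
  have h := congrFun (Matrix.mulVec_cramer A.transpose v) none
  simp only [Matrix.mulVec, dotProduct, Fintype.sum_option, Matrix.transpose_apply, h0, h1,
    Matrix.cramer_transpose_apply, Pi.smul_apply, hv, Matrix.det_transpose] at h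
  simpa using h

theorem cmh_sum {m q : ℕ} (rsq : Fin m → ℝ) (ρsq : Fin m → Fin m → ℝ)
    (g : Fin q → Fin m) (S : Finset (Fin q)) (hS : (cmhMat rsq ρsq g S).det ≠ 0) :
    ∑ j ∈ S, (cmhNum rsq ρsq g S j).det / (cmhMat rsq ρsq g S).det = 1 := by
  rw [← Finset.sum_div, div_eq_one_iff_eq hS, ← Finset.sum_coe_sort,
    ← cmh_cramer (cmhMat rsq ρsq g S) (fun b => cmEnt rsq ρsq CMIdx.star (cmhIdx g S b))]
  · refine Finset.sum_congr rfl fun s _ => ?_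
    congr 1
    ext a b
    rw [Matrix.updateRow_apply]
    rcases a with _ | a
    · simp [cmhNum, cmhMat]
    · by_cases h : a = s
      · simp [cmhNum, h]
      · have hne : (a : Fin q) ≠ s := fun hne => h (Subtype.ext hne)
        simp [cmhNum, cmhMat, h, hne]
  · simp [cmhIdx, cmEnt]
  · simp [cmhMat, cmhIdx, cmEnt]
  · intro s
    simp [cmhMat, cmhIdx, cmEnt]

theorem cmh_equiv {q k : ℕ} (S : Finset (Fin q)) (e : Fin k → Fin q)
    (he : Function.Injective e) (hS : ∀ x, x ∈ S ↔ ∃ t, e t = x) :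
    ∃ φ : Fin (k + 1) ≃ Option S, φ 0 = none ∧
      ∀ t : Fin k, φ t.succ = some ⟨e t, (hS _).2 ⟨t, rfl⟩⟩ := by
  refine ⟨(finSuccEquiv k).trans (Equiv.optionCongr (Equiv.ofBijective
    (fun t => (⟨e t, (hS _).2 ⟨t, rfl⟩⟩ : S)) ⟨?_, ?_⟩)), ?_, ?_⟩
  · intro a b h
    exact he (congrArg Subtype.val h)
  · rintro ⟨x, hx⟩
    obtain ⟨t, ht⟩ := (hS x).1 hx
    exact ⟨t, Subtype.ext ht⟩
  · simp
  · intro t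
    simp
    rfl

theorem cmh_den {m q k : ℕ} (rsq : Fin m → ℝ) (ρsq : Fin m → Fin m → ℝ)
    (g : Fin q → Fin m) (S : Finset (Fin q)) (e : Fin k → Fin q)
    (he : Function.Injective e) (hS : ∀ x, x ∈ S ↔ ∃ t, e t = x) :
    cmMinor rsq ρsq (CMIdx.zero :: List.ofFn fun t => CMIdx.pt (g (e t)))
        (CMIdx.zero :: List.ofFn fun t => CMIdx.pt (g (e t))) = (cmhMat rsq ρsq g S).det := by
  obtain ⟨φ, h0, h1⟩ := cmh_equiv S e he hS
  have hl : (CMIdx.zero :: List.ofFn fun t => CMIdx.pt (g (e t))) =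
      List.ofFn (fun a => cmhIdx g S (φ a)) := by
    simp [List.ofFn_succ, h0, h1, cmhIdx]
  rw [hl, cmh_list, ← Matrix.det_submatrix_equiv_self φ]
  rfl

theorem cmh_num {m q k : ℕ} (rsq : Fin m → ℝ) (ρsq : Fin m → Fin m → ℝ)
    (g : Fin q → Fin m) (S : Finset (Fin q)) (e : Fin (k + 1) → Fin q)
    (he : Function.Injective e) (hS : ∀ x, x ∈ S ↔ ∃ t, e t = x) :
    cmMinor rsq ρsq
        ([CMIdx.zero, CMIdx.star] ++ List.ofFn fun t : Fin k => CMIdx.pt (g (e t.succ)))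
        ([CMIdx.zero, CMIdx.pt (g (e 0))] ++
          List.ofFn fun t : Fin k => CMIdx.pt (g (e t.succ)))
      = (cmhNum rsq ρsq g S (e 0)).det := by
  obtain ⟨φ, h0, h1⟩ := cmh_equiv S e he hS
  have hl : ([CMIdx.zero, CMIdx.pt (g (e 0))] ++
          List.ofFn fun t : Fin k => CMIdx.pt (g (e t.succ))) =
      List.ofFn (fun a => cmhIdx g S (φ a)) := by
    simp only [List.ofFn_succ, h0, h1, cmhIdx]
    simp
  have hr : ([CMIdx.zero, CMIdx.star] ++
          List.ofFn fun t : Fin k => CMIdx.pt (g (e t.succ))) =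
      List.ofFn (fun a => if (φ a).map Subtype.val = some (e 0) then CMIdx.star
        else cmhIdx g S (φ a)) := by
    simp only [List.ofFn_succ, h0, h1, cmhIdx]
    simp [he.eq_iff]
  rw [hl, hr, cmh_list, ← Matrix.det_submatrix_equiv_self φ]
  rfl

theorem cmh_decomp (n : ℕ) : ∃ E : (Fin (n + 1) × Equiv.Perm (Fin n)) ≃ Equiv.Perm (Fin (n + 1)),
    ∃ f : Fin (n + 1) → Fin n → Fin (n + 1), (∀ p, Function.Injective (f p)) ∧
      ∀ p τ, E (p, τ) (Fin.last n) = p ∧ ∀ i, E (p, τ) i.castSucc = f p (τ i) := by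
  refine ⟨((Equiv.prodCongr Fin.revPerm (Equiv.permCongr Fin.revPerm)).trans
    Equiv.Perm.decomposeFin.symm).trans (Equiv.permCongr Fin.revPerm),
    fun p i => Fin.rev (Equiv.swap 0 (Fin.rev p) (Fin.rev i).succ), ?_, ?_⟩
  · intro p a b h
    simpa using h
  · intro p τ
    refine ⟨by simp [Equiv.permCongr_apply], fun i => by
      simp [Equiv.permCongr_apply, Fin.rev_castSucc]⟩

theorem cmh_perm (n : ℕ) : ∀ w : Finset (Fin (n + 2)) → Fin (n + 2) → ℝ,
    (∀ S : Finset (Fin (n + 2)), 3 ≤ S.card → ∑ j ∈ S, w S j = 1) →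
    ∑ σ : Equiv.Perm (Fin (n + 2)), ∏ i : Fin n,
      w ((Finset.Iic i.succ.succ).image σ) (σ i.succ.succ) = 2 := by
  induction n with
  | zero =>
    intro w hw
    simp [Fintype.card_perm]
  | succ n ih =>
    intro w hw
    obtain ⟨E, f, hf, hE⟩ := cmh_decomp (n + 2)
    rw [← E.sum_comp, Fintype.sum_prod_type]
    have key : ∀ p : Fin (n + 3), ∑ τ : Equiv.Perm (Fin (n + 2)), ∏ i : Fin (n + 1),
        w ((Finset.Iic i.succ.succ).image (E (p, τ))) (E (p, τ) i.succ.succ)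
        = 2 * w Finset.univ p := by
      intro p
      rw [← ih (fun S j => w (S.image (f p)) (f p j)), Finset.sum_mul]
      · refine Finset.sum_congr rfl fun τ _ => ?_
        rw [Fin.prod_univ_castSucc]
        congr 1
        · refine Finset.prod_congr rfl fun i _ => ?_
          have e1 : i.castSucc.succ.succ = i.succ.succ.castSucc := rfl
          rw [e1, (hE p τ).2]
          congr 1
          ext x
          simp only [Finset.mem_image, Finset.mem_Iic]
          constructor
          · rintro ⟨a, ha, rfl⟩
            have : (a : ℕ) < n + 2 := lt_of_le_of_lt (Fin.le_def.1 ha) (by simp)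
            refine ⟨τ ⟨a, this⟩, ⟨⟨a, this⟩, ha, rfl⟩, ?_⟩
            rw [← (hE p τ).2]
            rfl
          · rintro ⟨_, ⟨a, ha, rfl⟩, rfl⟩
            exact ⟨a.castSucc, ha, (hE p τ).2 a⟩
        · have e1 : (Fin.last n).succ.succ = Fin.last (n + 2) := rfl
          rw [e1, (hE p τ).1]
          congr 1
          ext x
          simp only [Finset.mem_image, Finset.mem_Iic, Finset.mem_univ, iff_true]
          exact ⟨(E (p, τ)).symm x, Fin.le_last _, by simp⟩
      · intro S hS
        rw [← hw (S.image (f p)) (by rwa [Finset.card_image_of_injective _ (hf p)]),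
          Finset.sum_image fun a _ b _ h => hf p h]
    simp_rw [key]
    rw [← Finset.mul_sum, hw _ (by simp)]
    norm_num

/-- Lemma 25 of Aomoto–Machida (`η_J = 1`): for a set `J` of `q ≥ 2` indices with all
principal minors `B(0K)` (`K ⊆ J`, `|K| ≥ 3`) nonzero, one has
`(1/2) Σ_{orderings (μ_0,…,μ_{q−1}) of J} ∏_{s=2}^{q−1}
  B(0 ⋆ μ_{s−1} … μ_0 ; 0 μ_s μ_{s−1} … μ_0) / B(0 μ_s μ_{s−1} … μ_0) = 1`. -/
theorem cm_eta_eq_one (m q : ℕ) (hq : 2 ≤ q)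
    (rsq : Fin m → ℝ) (ρsq : Fin m → Fin m → ℝ) (hsym : ∀ i j, ρsq i j = ρsq j i)
    (g : Fin q → Fin m) (hg : Function.Injective g)
    (hB : ∀ (k : ℕ), 3 ≤ k → ∀ e : Fin k → Fin q, Function.Injective e →
      cmMinor rsq ρsq (CMIdx.zero :: List.ofFn fun t => CMIdx.pt (g (e t)))
        (CMIdx.zero :: List.ofFn fun t => CMIdx.pt (g (e t))) ≠ 0) :
    (1 / 2 : ℝ) *
      ∑ σ : Equiv.Perm (Fin q), ∏ i : Fin (q - 2),
        cmMinor rsq ρsq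
            ([CMIdx.zero, CMIdx.star] ++
              List.ofFn fun t : Fin ((i : ℕ) + 2) =>
                CMIdx.pt (g (σ ⟨(i : ℕ) + 1 - (t : ℕ), by omega⟩)))
            ([CMIdx.zero, CMIdx.pt (g (σ ⟨(i : ℕ) + 2, by omega⟩))] ++
              List.ofFn fun t : Fin ((i : ℕ) + 2) =>
                CMIdx.pt (g (σ ⟨(i : ℕ) + 1 - (t : ℕ), by omega⟩))) /
          cmMinor rsq ρsq
            (CMIdx.zero :: List.ofFn fun t : Fin ((i : ℕ) + 3) =>
              CMIdx.pt (g (σ ⟨(i : ℕ) + 2 - (t : ℕ), by omega⟩)))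
            (CMIdx.zero :: List.ofFn fun t : Fin ((i : ℕ) + 3) =>
              CMIdx.pt (g (σ ⟨(i : ℕ) + 2 - (t : ℕ), by omega⟩))) = 1 := by
  obtain ⟨n, rfl⟩ : ∃ n, q = n + 2 := ⟨q - 2, by omega⟩
  have hw : ∀ S : Finset (Fin (n + 2)), 3 ≤ S.card →
      ∑ j ∈ S, (cmhNum rsq ρsq g S j).det / (cmhMat rsq ρsq g S).det = 1 := by
    intro S hS
    apply cmh_sum
    have hi : Function.Injective (fun t => (S.equivFin.symm t : Fin (n + 2))) :=
      Subtype.val_injective.comp S.equivFin.symm.injective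
    rw [← cmh_den rsq ρsq g S _ hi]
    · exact hB _ hS _ hi
    · intro x
      constructor
      · intro hx
        exact ⟨S.equivFin ⟨x, hx⟩, by simp⟩
      · rintro ⟨t, rfl⟩
        exact (S.equivFin.symm t).2
  have main := cmh_perm n _ hw
  refine (congrArg (fun x : ℝ => 1 / 2 * x) (Eq.trans ?_ main)).trans (by norm_num)
  refine Finset.sum_congr rfl fun σ _ => ?_
  change ∏ i : Fin n, _ = _
  refine Finset.prod_congr rfl fun i _ => ?_
  have hi : Function.Injective (fun t : Fin ((i : ℕ) + 3) =>
      σ ⟨(i : ℕ) + 2 - (t : ℕ), by omega⟩) := by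
    intro a b h
    have := congrArg Fin.val (σ.injective h)
    simp only at this
    exact Fin.ext (by omega)
  have hS : ∀ x, x ∈ (Finset.Iic i.succ.succ).image σ ↔
      ∃ t : Fin ((i : ℕ) + 3), σ ⟨(i : ℕ) + 2 - (t : ℕ), by omega⟩ = x := by
    intro x
    simp only [Finset.mem_image, Finset.mem_Iic]
    constructor
    · rintro ⟨a, ha, rfl⟩
      have hale : (a : ℕ) ≤ i + 2 := ha
      refine ⟨⟨i + 2 - a, by omega⟩, congrArg σ (Fin.ext ?_)⟩
      simp only
      omega
    · rintro ⟨t, rfl⟩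
      refine ⟨_, ?_, rfl⟩
      rw [Fin.le_def]
      simp
  rw [← cmh_den rsq ρsq g _ _ hi hS]
  congr 1
  have h2 := cmh_num rsq ρsq g _ _ hi hS
  refine Eq.trans ?_ h2
  have e1 : ∀ t : Fin ((i : ℕ) + 2), (i : ℕ) + 2 - (t.succ : ℕ) = i + 1 - t := by
    intro t
    simp only [Fin.val_succ]
    omega
  simp only [e1]
  rfl
end

section
/- Let μ_1, …, μ_k ∈ {1, …, m} be distinct indices. Then for arbitrary real Cayley–Menger data: (i) B(0 μ_1 … μ_k) = Σ_{s=1}^{k} B(0 ⋆ μ_1 … μ̂_s … μ_k ; 0 μ_s μ_1 … μ̂_s … μ_k); and (ii) for any further index q distinct from μ_1, …, μ_k, B(0 ⋆ μ_1 … μ_k) = Σ_{s=1}^{k} B(0 q ⋆ μ_1 … μ̂_s … μ_k ; 0 μ_s ⋆ μ_1 … μ̂_s … μ_k) + B(0 q μ_1 … μ_k ; 0 ⋆ μ_1 … μ_k). Here μ̂_s means that μ_s is omitted from the sequence. -/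
theorem cmMinor_ofFn_aux {m : ℕ} (rsq : Fin m → ℝ) (ρsq : Fin m → Fin m → ℝ) {N : ℕ}
    (f g : Fin N → CMIdx m) :
    cmMinor rsq ρsq (List.ofFn f) (List.ofFn g) =
      Matrix.det (Matrix.of fun i j : Fin N => cmEnt rsq ρsq (f i) (g j)) := by
  unfold cmMinor
  rw [dif_pos (by simp)]
  rw [← Matrix.det_submatrix_equiv_self (finCongr (List.length_ofFn (f := f)))]
  congr 1
  ext i j
  simp [finCongr]
  rfl

theorem det_updateRow_sum_aux {n : ℕ} (M : Matrix (Fin (n + 1)) (Fin (n + 1)) ℝ)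
    (h0 : M 0 0 = 0) (h1 : ∀ j : Fin n, M j.succ 0 = 1) (y : Fin (n + 1) → ℝ) (hy : y 0 = 1) :
    M.det = ∑ s : Fin n, (M.updateRow s.succ y).det := by
  have key : ∀ c, ∑ s : Fin n, M.adjugate c s.succ = if c = 0 then M.det else 0 := by
    intro c
    have h := congrFun (congrFun (Matrix.adjugate_mul M) c) 0
    rw [Matrix.mul_apply, Fin.sum_univ_succ] at h
    simpa [h0, h1, Matrix.one_apply] using h
  have hc : ∀ s : Fin n, (M.updateRow s.succ y).det = ∑ c, y c * M.adjugate c s.succ := by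
    intro s
    have h := Matrix.cramer_transpose_apply M y s.succ
    rw [← h, Matrix.cramer_eq_adjugate_mulVec, ← Matrix.adjugate_transpose]
    simp [Matrix.mulVec, dotProduct, mul_comm]
  simp_rw [hc]
  rw [Finset.sum_comm]
  simp_rw [← Finset.mul_sum, key]
  simp [hy]

theorem cm_general_aux {m n : ℕ} (rsq : Fin m → ℝ) (ρsq : Fin m → Fin m → ℝ)
    (v : Fin (n + 1) → CMIdx m) (y : CMIdx m) (hv : ∀ i, v i ≠ CMIdx.zero)
    (hy : y ≠ CMIdx.zero) :
    cmMinor rsq ρsq (CMIdx.zero :: List.ofFn v) (CMIdx.zero :: List.ofFn v) =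
      ∑ s : Fin (n + 1), cmMinor rsq ρsq
        (CMIdx.zero :: y :: List.ofFn fun t => v (s.succAbove t))
        (CMIdx.zero :: v s :: List.ofFn fun t => v (s.succAbove t)) := by
  have ent1 : ∀ x : CMIdx m, x ≠ CMIdx.zero → cmEnt rsq ρsq x CMIdx.zero = 1 := by
    intro x hx
    cases x <;> simp_all [cmEnt]
  have c1 : ∀ {N : ℕ} (a : CMIdx m) (f : Fin N → CMIdx m),
      a :: List.ofFn f = List.ofFn (Fin.cons a f : Fin (N + 1) → CMIdx m) := by
    intro N a f
    simp [List.ofFn_succ]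
  simp_rw [c1, cmMinor_ofFn_aux]
  rw [det_updateRow_sum_aux _ (by simp [cmEnt]) (by intro j; simpa using ent1 _ (hv j))
    (fun j => cmEnt rsq ρsq y ((Fin.cons CMIdx.zero v : Fin (n + 2) → CMIdx m) j))
    (by simpa using ent1 _ hy)]
  refine Finset.sum_congr rfl fun s _ => ?_
  rw [← Matrix.det_submatrix_equiv_self (Equiv.Perm.decomposeFin.symm (0, s.cycleRange.symm))]
  congr 1
  ext i j
  have hcol : (Fin.cons CMIdx.zero v : Fin (n + 2) → CMIdx m)
      (Equiv.Perm.decomposeFin.symm (0, s.cycleRange.symm) j) =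
      (Fin.cons CMIdx.zero (Fin.cons (v s) fun t => v (s.succAbove t)) :
        Fin (n + 2) → CMIdx m) j := by
    refine Fin.cases ?_ (fun j => ?_) j
    · simp
    · refine Fin.cases ?_ (fun j => ?_) j <;> simp
  rw [Matrix.submatrix_apply, Matrix.updateRow_apply, Matrix.of_apply, Matrix.of_apply, hcol]
  refine Fin.cases ?_ (fun i => ?_) i
  · simp [(Fin.succ_ne_zero s).symm]
  · refine Fin.cases ?_ (fun i => ?_) i
    · simp
    · simp [Fin.succAbove_ne]

theorem skip_eq_aux {n : ℕ} (s : Fin (n + 1)) (t : Fin n)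
    (h : (if (t : ℕ) < (s : ℕ) then (t : ℕ) else (t : ℕ) + 1) < n + 1) :
    (⟨if (t : ℕ) < (s : ℕ) then (t : ℕ) else (t : ℕ) + 1, h⟩ : Fin (n + 1)) = s.succAbove t := by
  ext
  simp only [Fin.succAbove, Fin.lt_def, Fin.val_castSucc]
  split <;> simp


/-- Cofactor expansions (28)–(29) of Aomoto–Machida, for arbitrary real data and distinct
indices `μ_1, …, μ_k` (and a further index `q`):
(i) `B(0 μ_1…μ_k) = Σ_s B(0 ⋆ μ_1…μ̂_s…μ_k ; 0 μ_s μ_1…μ̂_s…μ_k)`;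
(ii) `B(0 ⋆ μ_1…μ_k) = Σ_s B(0 q ⋆ μ_1…μ̂_s…μ_k ; 0 μ_s ⋆ μ_1…μ̂_s…μ_k)
      + B(0 q μ_1…μ_k ; 0 ⋆ μ_1…μ_k)`. -/
theorem cm_cofactor_expansions (m k : ℕ)
    (rsq : Fin m → ℝ) (ρsq : Fin m → Fin m → ℝ) (hsym : ∀ i j, ρsq i j = ρsq j i)
    (μ : Fin k → Fin m) (hμ : Function.Injective μ)
    (q : Fin m) (hq : ∀ s, q ≠ μ s) :
    (cmMinor rsq ρsq (CMIdx.zero :: List.ofFn fun t => CMIdx.pt (μ t))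
        (CMIdx.zero :: List.ofFn fun t => CMIdx.pt (μ t)) =
      ∑ s : Fin k,
        cmMinor rsq ρsq
          ([CMIdx.zero, CMIdx.star] ++
            List.ofFn fun t : Fin (k - 1) =>
              CMIdx.pt (μ ⟨if (t : ℕ) < (s : ℕ) then (t : ℕ) else (t : ℕ) + 1,
                by split <;> omega⟩))
          ([CMIdx.zero, CMIdx.pt (μ s)] ++
            List.ofFn fun t : Fin (k - 1) =>
              CMIdx.pt (μ ⟨if (t : ℕ) < (s : ℕ) then (t : ℕ) else (t : ℕ) + 1,
                by split <;> omega⟩))) ∧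
    (cmMinor rsq ρsq (CMIdx.zero :: CMIdx.star :: List.ofFn fun t => CMIdx.pt (μ t))
        (CMIdx.zero :: CMIdx.star :: List.ofFn fun t => CMIdx.pt (μ t)) =
      (∑ s : Fin k,
        cmMinor rsq ρsq
          ([CMIdx.zero, CMIdx.pt q, CMIdx.star] ++
            List.ofFn fun t : Fin (k - 1) =>
              CMIdx.pt (μ ⟨if (t : ℕ) < (s : ℕ) then (t : ℕ) else (t : ℕ) + 1,
                by split <;> omega⟩))
          ([CMIdx.zero, CMIdx.pt (μ s), CMIdx.star] ++
            List.ofFn fun t : Fin (k - 1) =>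
              CMIdx.pt (μ ⟨if (t : ℕ) < (s : ℕ) then (t : ℕ) else (t : ℕ) + 1,
                by split <;> omega⟩))) +
        cmMinor rsq ρsq (CMIdx.zero :: CMIdx.pt q :: List.ofFn fun t => CMIdx.pt (μ t))
          (CMIdx.zero :: CMIdx.star :: List.ofFn fun t => CMIdx.pt (μ t))) := by
  constructor
  · cases k with
    | zero =>
      have h := cmMinor_ofFn_aux rsq ρsq (fun _ : Fin 1 => CMIdx.zero) (fun _ => CMIdx.zero)
      simpa [cmEnt] using h
    | succ n =>
      rw [cm_general_aux rsq ρsq (fun t => CMIdx.pt (μ t)) CMIdx.star (by simp) (by simp)]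
      refine Finset.sum_congr rfl fun s _ => ?_
      have e : (fun t : Fin n => (CMIdx.pt (μ (s.succAbove t)) : CMIdx m)) = fun t : Fin n =>
          CMIdx.pt (μ ⟨if (t : ℕ) < (s : ℕ) then (t : ℕ) else (t : ℕ) + 1,
            by split <;> omega⟩) := by
        funext t
        rw [skip_eq_aux]
      rw [e]
      rfl
  · have h := cm_general_aux rsq ρsq
      (Fin.cons CMIdx.star (fun t => CMIdx.pt (μ t)) : Fin (k + 1) → CMIdx m) (CMIdx.pt q)
      (by intro i; refine Fin.cases ?_ (fun i => ?_) i <;> simp) (by simp)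
    rw [Fin.sum_univ_succ] at h
    simp only [List.ofFn_cons, Fin.cons_zero, Fin.cons_succ, Fin.succAbove_zero] at h
    rw [h, add_comm]
    congr 1
    refine Finset.sum_congr rfl fun s _ => ?_
    cases k with
    | zero => exact s.elim0
    | succ n =>
      have e : (fun t : Fin n => (CMIdx.pt (μ (s.succAbove t)) : CMIdx m)) = fun t : Fin n =>
          CMIdx.pt (μ ⟨if (t : ℕ) < (s : ℕ) then (t : ℕ) else (t : ℕ) + 1,
            by split <;> omega⟩) := by
        funext t
        rw [skip_eq_aux]
      rw [List.ofFn_succ]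
      simp only [Fin.succ_succAbove_zero, Fin.succ_succAbove_succ, Fin.cons_zero, Fin.cons_succ]
      rw [e]
      rfl
end

section
/- Let n ≥ 2 and N = (1, 2, …, n+1). For arbitrary real Cayley–Menger data and each l ∈ {2, 3, …, n+1}: B(0 2 1 ; 0 l 1) · B(0 ∂_2 N) − Σ_{k=3}^{n} B(0 k 1 ; 0 l 1) · B(0 2 ∂_2∂_k N ; 0 k ∂_2∂_k N) − B(0 n+1 1 ; 0 l 1) · B(0 2 ∂_2∂_{n+1} N ; 0 n+1 ∂_2∂_{n+1} N) equals −B(0 N) if l = 2, and equals 0 if l ∈ {3, …, n+1}. -/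
/-- Cofactor expansion along a list enumeration of the index type. -/
lemma cm_key {ι : Type} [Fintype ι] [DecidableEq ι] (A : Matrix ι ι ℝ) (R : List ι) (j k : ι)
    (hnd : (k :: R).Nodup) (hall : ∀ x, x ∈ k :: R) :
    Matrix.det (Matrix.of fun a b : Fin R.length =>
      A (R.get a) (Equiv.swap j k (R.get b))) =
      (Equiv.Perm.sign (Equiv.swap j k) : ℝ) * A.adjugate j k := by
  let e : Fin (R.length + 1) ≃ ι := List.Nodup.getEquivOfForallMemList (k :: R) hnd hall
  have he0 : e 0 = k := rfl
  have hes : ∀ a : Fin R.length, e a.succ = R.get a := fun a => rfl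
  have h1 : Matrix.det (Matrix.of fun a b : Fin (R.length + 1) =>
      (A.updateRow k (Pi.single j 1)) (e a) (Equiv.swap j k (e b))) =
      (Equiv.Perm.sign (Equiv.swap j k) : ℝ) * A.adjugate j k := by
    rw [Matrix.adjugate_apply, ← Matrix.det_permute', ← Matrix.det_submatrix_equiv_self e]
    rfl
  rw [← h1, Matrix.det_succ_row_zero, Finset.sum_eq_single 0]
  · simp only [Matrix.of_apply, he0, Matrix.updateRow_self, Equiv.swap_apply_right,
      Pi.single_eq_same, Fin.val_zero, pow_zero, one_mul]
    congr 1
    ext a b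
    simp only [Matrix.submatrix_apply, Matrix.of_apply, Fin.zero_succAbove, hes]
    rw [Matrix.updateRow_ne]
    rintro h
    exact (List.nodup_cons.mp hnd).1 (h ▸ List.get_mem R a)
  · intro b _ hb
    have : Equiv.swap j k (e b) ≠ j := by
      intro h
      apply hb
      have h2 : e b = e 0 := by
        rw [he0]
        apply (Equiv.swap j k).injective
        rw [h, Equiv.swap_apply_right]
      exact e.injective h2
    simp [he0, this]
  · simp

lemma cmMinor_map {m : ℕ} {ι : Type} (rsq : Fin m → ℝ) (ρsq : Fin m → Fin m → ℝ)
    (R : List ι) (f g : ι → CMIdx m) :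
    cmMinor rsq ρsq (R.map f) (R.map g) =
      Matrix.det (Matrix.of fun a b : Fin R.length =>
        cmEnt rsq ρsq (f (R.get a)) (g (R.get b))) := by
  unfold cmMinor
  rw [dif_pos (by simp)]
  rw [← Matrix.det_submatrix_equiv_self (finCongr (List.length_map (as := R) f)).symm]
  congr 1
  ext a b
  simp

/-- Embedding of the index set without the star. -/
def cmPhi {m : ℕ} : Option (Fin m) → CMIdx m
  | none => CMIdx.zero
  | some i => CMIdx.pt i

/-- The matrix with rows and columns `0, 1, …, m`. -/
def cmMat {m : ℕ} (rsq : Fin m → ℝ) (ρsq : Fin m → Fin m → ℝ) :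
    Matrix (Option (Fin m)) (Option (Fin m)) ℝ :=
  fun i j => cmEnt rsq ρsq (cmPhi i) (cmPhi j)

lemma cm_diag {m : ℕ} (rsq : Fin m → ℝ) (ρsq : Fin m → Fin m → ℝ) (j : Fin m) :
    cmMinor rsq ρsq (CMIdx.zero :: ((List.finRange m).erase j).map CMIdx.pt)
      (CMIdx.zero :: ((List.finRange m).erase j).map CMIdx.pt) =
      (cmMat rsq ρsq).adjugate (some j) (some j) := by
  have hn := (List.nodup_finRange m)
  have h := cm_key (cmMat rsq ρsq) (none :: ((List.finRange m).erase j).map some)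
    (some j) (some j)
    (by
      have := (hn.erase j).map (Option.some_injective _)
      simp [hn.mem_erase_iff, this])
    (by
      rintro (_ | x)
      · simp
      · by_cases hx : x = j <;> simp [hn.mem_erase_iff, hx])
  have h2 := cmMinor_map rsq ρsq (none :: ((List.finRange m).erase j).map some) cmPhi cmPhi
  have hl : List.map cmPhi (none :: ((List.finRange m).erase j).map some) =
      CMIdx.zero :: ((List.finRange m).erase j).map CMIdx.pt := by
    simp [cmPhi, Function.comp_def]
  rw [hl] at h2
  rw [h2]
  simp only [Equiv.swap_self, Equiv.refl_apply, Equiv.Perm.sign_refl, Units.val_one,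
    Int.cast_one, one_mul] at h
  exact h

lemma cm_off {m : ℕ} (rsq : Fin m → ℝ) (ρsq : Fin m → Fin m → ℝ) (j k : Fin m) (hjk : j ≠ k) :
    cmMinor rsq ρsq
      ([CMIdx.zero, CMIdx.pt j] ++ (((List.finRange m).erase j).erase k).map CMIdx.pt)
      ([CMIdx.zero, CMIdx.pt k] ++ (((List.finRange m).erase j).erase k).map CMIdx.pt) =
      -(cmMat rsq ρsq).adjugate (some j) (some k) := by
  have hn := (List.nodup_finRange m)
  have hn' := hn.erase j
  have h := cm_key (cmMat rsq ρsq)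
    (none :: some j :: (((List.finRange m).erase j).erase k).map some)
    (some j) (some k)
    (by
      have := (hn'.erase k).map (Option.some_injective _)
      simp [hn'.mem_erase_iff, hn.mem_erase_iff, this, hjk.symm])
    (by
      rintro (_ | x)
      · simp
      · by_cases hx : x = j <;> by_cases hx' : x = k <;>
          simp [hn'.mem_erase_iff, hn.mem_erase_iff, hx, hx'])
  have h2 := cmMinor_map rsq ρsq (none :: some j :: (((List.finRange m).erase j).erase k).map some)
    cmPhi (fun x => cmPhi (Equiv.swap (some j) (some k) x))
  have hl : List.map cmPhi (none :: some j :: (((List.finRange m).erase j).erase k).map some) =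
      [CMIdx.zero, CMIdx.pt j] ++ (((List.finRange m).erase j).erase k).map CMIdx.pt := by
    simp [cmPhi, Function.comp_def]
  have hr : List.map (fun x => cmPhi (Equiv.swap (some j) (some k) x))
      (none :: some j :: (((List.finRange m).erase j).erase k).map some) =
      [CMIdx.zero, CMIdx.pt k] ++ (((List.finRange m).erase j).erase k).map CMIdx.pt := by
    have h0 : Equiv.swap (some j) (some k) none = none :=
      Equiv.swap_apply_of_ne_of_ne (by simp) (by simp)
    simp only [List.map_cons, h0, Equiv.swap_apply_left, cmPhi, List.map_map, List.cons_append,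
      List.nil_append, List.cons.injEq, true_and]
    apply List.map_congr_left
    intro x hx
    rw [hn'.mem_erase_iff, hn.mem_erase_iff] at hx
    simp only [Function.comp_apply]
    rw [Equiv.swap_apply_of_ne_of_ne (by simpa using hx.2.1) (by simpa using hx.1)]
  rw [hl, hr] at h2
  rw [h2]
  rw [Equiv.Perm.sign_swap (by simpa using hjk)] at h
  simp only [Units.val_neg, Units.val_one, Int.cast_neg, Int.cast_one, neg_mul, one_mul] at h
  exact h

lemma cm_full {m : ℕ} (rsq : Fin m → ℝ) (ρsq : Fin m → Fin m → ℝ) :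
    cmMinor rsq ρsq (CMIdx.zero :: (List.finRange m).map CMIdx.pt)
      (CMIdx.zero :: (List.finRange m).map CMIdx.pt) = (cmMat rsq ρsq).det := by
  have hn := (List.nodup_finRange m)
  let L : List (Option (Fin m)) := none :: (List.finRange m).map some
  have hnd : L.Nodup := by
    have := hn.map (Option.some_injective _)
    simp [L, this]
  have hall : ∀ x, x ∈ L := by
    rintro (_ | x) <;> simp [L]
  have h2 := cmMinor_map rsq ρsq L cmPhi cmPhi
  have hl : List.map cmPhi L = CMIdx.zero :: (List.finRange m).map CMIdx.pt := by
    simp [L, cmPhi, Function.comp_def]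
  rw [hl] at h2
  rw [h2, ← Matrix.det_submatrix_equiv_self (List.Nodup.getEquivOfForallMemList L hnd hall)]
  rfl

lemma cm_three {m : ℕ} (rsq : Fin m → ℝ) (ρsq : Fin m → Fin m → ℝ) (k l o : Fin m) :
    cmMinor rsq ρsq [CMIdx.zero, CMIdx.pt k, CMIdx.pt o] [CMIdx.zero, CMIdx.pt l, CMIdx.pt o] =
      -(cmMat rsq ρsq (some k) (some l) - cmMat rsq ρsq (some k) (some o)
        - cmMat rsq ρsq (some o) (some l) * cmMat rsq ρsq (some k) none) := by
  have h := cmMinor_map rsq ρsq [(0 : Fin 3), 1, 2]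
    ![CMIdx.zero, CMIdx.pt k, CMIdx.pt o] ![CMIdx.zero, CMIdx.pt l, CMIdx.pt o]
  have h2 := h.trans (Matrix.det_fin_three _)
  refine Eq.trans h2 ?_
  simp [cmMat, cmPhi, cmEnt]
  ring

lemma cm_sum {m : ℕ} (rsq : Fin m → ℝ) (ρsq : Fin m → Fin m → ℝ) (j l o : Fin m) (hoj : o ≠ j) :
    ∑ k : Fin m, (cmMat rsq ρsq (some k) (some l) - cmMat rsq ρsq (some k) (some o)
        - cmMat rsq ρsq (some o) (some l) * cmMat rsq ρsq (some k) none) *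
        (cmMat rsq ρsq).adjugate (some j) (some k) =
      if j = l then (cmMat rsq ρsq).det else 0 := by
  set A := cmMat rsq ρsq with hA
  have h : ∀ c, ∑ k, A k c * A.adjugate (some j) k = if some j = c then A.det else 0 := by
    intro c
    have := congrFun (congrFun (Matrix.adjugate_mul A) (some j)) c
    rw [Matrix.mul_apply] at this
    simp only [Matrix.smul_apply, Matrix.one_apply, smul_eq_mul, mul_ite, mul_one, mul_zero] at this
    rw [← this]
    exact Finset.sum_congr rfl fun _ _ => mul_comm _ _
  have h1 := h (some l)
  have h2 := h (some o)
  have h3 := h none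
  rw [Fintype.sum_option] at h1 h2 h3
  simp only [Option.some.injEq, hoj.symm, if_false, reduceCtorEq] at h1 h2 h3
  have e1 : A none (some l) = 1 := by simp [hA, cmMat, cmPhi, cmEnt]
  have e2 : A none (some o) = 1 := by simp [hA, cmMat, cmPhi, cmEnt]
  have e3 : A none none = 0 := by simp [hA, cmMat, cmPhi, cmEnt]
  rw [e1] at h1
  rw [e2] at h2
  rw [e3] at h3
  simp only [sub_mul, Finset.sum_sub_distrib, mul_assoc, ← Finset.mul_sum]
  rw [← h1]
  linear_combination -h2 - A (some o) (some l) * h3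

/-- Lemma 31 of Aomoto–Machida: for `n ≥ 2`, `N = (1,…,n+1)`, arbitrary real data and
`l ∈ {2,…,n+1}`:
`B(021;0l1)·B(0 ∂₂N) − Σ_{k=3}^{n} B(0k1;0l1)·B(02 ∂₂∂ₖN;0k ∂₂∂ₖN)
  − B(0 (n+1) 1;0l1)·B(02 ∂₂∂_{n+1}N;0 (n+1) ∂₂∂_{n+1}N)`
equals `−B(0N)` if `l = 2` and `0` otherwise.
(1-based index `j` is represented by `j−1 ∈ Fin (n+1)`.) -/
theorem cm_lemma31 (n : ℕ) (hn : 2 ≤ n)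
    (rsq : Fin (n + 1) → ℝ) (ρsq : Fin (n + 1) → Fin (n + 1) → ℝ)
    (hsym : ∀ i j, ρsq i j = ρsq j i)
    (l : ℕ) (hl2 : 2 ≤ l) (hl : l ≤ n + 1) :
    cmMinor rsq ρsq
          [CMIdx.zero, CMIdx.pt ⟨1, by omega⟩, CMIdx.pt ⟨0, by omega⟩]
          [CMIdx.zero, CMIdx.pt ⟨l - 1, by omega⟩, CMIdx.pt ⟨0, by omega⟩] *
        cmMinor rsq ρsq
          (CMIdx.zero ::
            ((List.finRange (n + 1)).erase ⟨1, by omega⟩).map CMIdx.pt)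
          (CMIdx.zero ::
            ((List.finRange (n + 1)).erase ⟨1, by omega⟩).map CMIdx.pt) -
      (∑ i : Fin (n - 2),
        cmMinor rsq ρsq
            [CMIdx.zero, CMIdx.pt ⟨(i : ℕ) + 2, by omega⟩, CMIdx.pt ⟨0, by omega⟩]
            [CMIdx.zero, CMIdx.pt ⟨l - 1, by omega⟩, CMIdx.pt ⟨0, by omega⟩] *
          cmMinor rsq ρsq
            ([CMIdx.zero, CMIdx.pt ⟨1, by omega⟩] ++
              (((List.finRange (n + 1)).erase ⟨1, by omega⟩).erase
                ⟨(i : ℕ) + 2, by omega⟩).map CMIdx.pt)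
            ([CMIdx.zero, CMIdx.pt ⟨(i : ℕ) + 2, by omega⟩] ++
              (((List.finRange (n + 1)).erase ⟨1, by omega⟩).erase
                ⟨(i : ℕ) + 2, by omega⟩).map CMIdx.pt)) -
      cmMinor rsq ρsq
          [CMIdx.zero, CMIdx.pt ⟨n, by omega⟩, CMIdx.pt ⟨0, by omega⟩]
          [CMIdx.zero, CMIdx.pt ⟨l - 1, by omega⟩, CMIdx.pt ⟨0, by omega⟩] *
        cmMinor rsq ρsq
          ([CMIdx.zero, CMIdx.pt ⟨1, by omega⟩] ++
            (((List.finRange (n + 1)).erase ⟨1, by omega⟩).erase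
              ⟨n, by omega⟩).map CMIdx.pt)
          ([CMIdx.zero, CMIdx.pt ⟨n, by omega⟩] ++
            (((List.finRange (n + 1)).erase ⟨1, by omega⟩).erase
              ⟨n, by omega⟩).map CMIdx.pt) =
      if l = 2 then
        -cmMinor rsq ρsq (CMIdx.zero :: (List.finRange (n + 1)).map CMIdx.pt)
          (CMIdx.zero :: (List.finRange (n + 1)).map CMIdx.pt)
      else 0 := by
  obtain ⟨p, rfl⟩ : ∃ p, n = p + 2 := ⟨n - 2, by omega⟩
  have hs := cm_sum rsq ρsq ⟨1, by omega⟩ ⟨l - 1, by omega⟩ ⟨0, by omega⟩ (by simp)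
  rw [cm_diag, cm_full, cm_three, cm_three, cm_off _ _ _ _ (by simp)]
  have hsum : ∀ i : Fin (p + 2 - 2), (⟨1, by omega⟩ : Fin (p + 2 + 1)) ≠ ⟨(i : ℕ) + 2, by omega⟩ := by
    intro i
    simp
  simp only [cm_three, cm_off _ _ _ _ (hsum _)]
  have h00 : cmMat rsq ρsq (some ⟨0, by omega⟩) (some ⟨0, by omega⟩) = 0 := by
    simp [cmMat, cmPhi, cmEnt]
  have h0n : cmMat rsq ρsq (some ⟨0, by omega⟩) none = 1 := by
    simp [cmMat, cmPhi, cmEnt]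
  have hif : ((⟨1, by omega⟩ : Fin (p + 2 + 1)) = ⟨l - 1, by omega⟩) ↔ l = 2 := by
    simp only [Fin.mk.injEq]
    omega
  rw [Fin.sum_univ_succ, Fin.sum_univ_succ, Fin.sum_univ_castSucc] at hs
  simp only [hif] at hs
  have hz : (0 : Fin (p + 2 + 1)) = ⟨0, by omega⟩ := rfl
  have ho : (Fin.succ 0 : Fin (p + 2 + 1)) = ⟨1, by omega⟩ := rfl
  have hk : ∀ i : Fin p, (i.castSucc.succ.succ : Fin (p + 2 + 1)) = ⟨(i : ℕ) + 2, by omega⟩ :=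
    fun i => rfl
  have hla : ((Fin.last p).succ.succ : Fin (p + 2 + 1)) = ⟨p + 2, by omega⟩ := rfl
  rw [hz, ho, hla, h00, h0n] at hs
  simp only [hk] at hs
  simp only [neg_mul_neg]
  change _ - (∑ i : Fin p, _) - _ = _
  split_ifs at hs ⊢ with h
  · linear_combination -hs
  · linear_combination -hs
end

section
/- Let P_1, …, P_m ∈ ℝ^n with m ≥ n+1 and ρ_{jk}^2 = ‖P_j − P_k‖^2, let N = (1, 2, …, n+1), let μ_1, …, μ_q ∈ N be distinct (1 ≤ q ≤ n), and let k_1, …, k_q ∈ {n+2, …, m} be distinct. Then ∏_{s=1}^{q} B(0 k_s k_{s−1} … k_1 ∂_{μ_s}⋯∂_{μ_1} N ; 0 μ_s k_{s−1} … k_1 ∂_{μ_s}⋯∂_{μ_1} N) = B(0 k_q k_{q−1} … k_1 ∂_{μ_q}⋯∂_{μ_1} N ; 0 μ_q μ_{q−1} … μ_1 ∂_{μ_q}⋯∂_{μ_1} N) · ∏_{s=1}^{q−1} B(0 k_s k_{s−1} … k_1 ∂_{μ_s}⋯∂_{μ_1} N), where ∂_{μ_s}⋯∂_{μ_1} N denotes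 the increasing sequence N with μ_1, …, μ_s removed. -/
/-- Minor of the Cayley–Menger matrix of points `P` (index `none` is the extra `0`-row of
ones, `some j` is the point `P j`), with given row and column index sequences. -/
noncomputable def pMinor {n m : ℕ} (P : Fin m → EuclideanSpace ℝ (Fin n))
    (rows cols : List (Option (Fin m))) : ℝ :=
  if h : rows.length = cols.length then
    Matrix.det (Matrix.of fun a b : Fin rows.length =>
      match rows.get a, cols.get (Fin.cast h b) with
      | none, none => 0
      | none, some _ => 1
      | some _, none => 1
      | some i, some j => ‖P i - P j‖ ^ 2)
  else 0

/-- The increasing sequence `∂_{μ_s}⋯∂_{μ_1} N`, i.e. `N = (1,…,n+1)` with the first `s`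
of the `μ`'s removed, embedded in `{1,…,m}`. -/
def delSeq {n m q : ℕ} (hm : n + 1 ≤ m) (μ : Fin q → Fin (n + 1)) (s : ℕ) :
    List (Option (Fin m)) :=
  (((List.finRange (n + 1)).filter fun a => a ∉ (List.ofFn μ).take s).map
    fun a => some (Fin.castLE hm a))

/-- Left vectors of the rank factorization. -/
noncomputable def cmU {n m : ℕ} (P : Fin m → EuclideanSpace ℝ (Fin n)) :
    Option (Fin m) → Fin (n + 2) → ℝ
  | none => Fin.cons 1 (Fin.cons 0 fun _ => 0)
  | some i => Fin.cons (‖P i‖ ^ 2) (Fin.cons 1 fun t => P i t)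

/-- Right vectors of the rank factorization. -/
noncomputable def cmV {n m : ℕ} (P : Fin m → EuclideanSpace ℝ (Fin n)) :
    Option (Fin m) → Fin (n + 2) → ℝ
  | none => Fin.cons 0 (Fin.cons 1 fun _ => 0)
  | some i => Fin.cons 1 (Fin.cons (‖P i‖ ^ 2) fun t => -2 * P i t)

/-- Determinant of the vectors indexed by a list. -/
noncomputable def cmD {N m : ℕ} (u : Option (Fin m) → Fin N → ℝ)
    (l : List (Option (Fin m))) : ℝ :=
  Matrix.det (Matrix.of fun a b : Fin N => u (l.getD a none) b)

lemma pMinor_eq {n m : ℕ} (P : Fin m → EuclideanSpace ℝ (Fin n))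
    (rows cols : List (Option (Fin m))) (N : ℕ) (h1 : rows.length = N) (h2 : cols.length = N) :
    pMinor P rows cols = Matrix.det (Matrix.of fun a b : Fin N =>
      match rows.getD a none, cols.getD b none with
      | none, none => (0 : ℝ)
      | none, some _ => 1
      | some _, none => 1
      | some i, some j => ‖P i - P j‖ ^ 2) := by
  subst h1
  unfold pMinor
  rw [dif_pos h2.symm]
  congr 1
  ext a b
  have hb : (b : ℕ) < cols.length := by rw [h2]; exact b.2
  have e1 : rows.getD a none = rows.get a := by simp
  have e2 : cols.getD b none = cols.get (Fin.cast h2.symm b) := by simp [hb]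
  simp only [Matrix.of_apply, e1, e2]

lemma pMinor_factor {n m : ℕ} (P : Fin m → EuclideanSpace ℝ (Fin n))
    (rows cols : List (Option (Fin m))) (h1 : rows.length = n + 2) (h2 : cols.length = n + 2) :
    pMinor P rows cols = cmD (cmU P) rows * cmD (cmV P) cols := by
  rw [pMinor_eq P rows cols _ h1 h2]
  unfold cmD
  conv_rhs => rw [← Matrix.det_transpose (Matrix.of fun a b : Fin (n + 2) => cmV P (cols.getD a none) b)]
  rw [← Matrix.det_mul]
  congr 1
  ext a b
  simp only [Matrix.mul_apply, Matrix.of_apply, Matrix.transpose_apply]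
  generalize rows.getD a none = x
  generalize cols.getD b none = y
  rcases x with _ | i <;> rcases y with _ | j
  · simp [cmU, cmV, Fin.sum_univ_succ]
  · simp [cmU, cmV, Fin.sum_univ_succ]
  · simp [cmU, cmV, Fin.sum_univ_succ]
  · have h : ∑ t, P i t * (-2 * P j t) = -2 * inner ℝ (P i) (P j) := by
      rw [PiLp.inner_apply, Finset.mul_sum]
      refine Finset.sum_congr rfl fun t _ => ?_
      simp
      ring
    rw [Fin.sum_univ_succ, Fin.sum_univ_succ]
    simp only [cmU, cmV, Fin.cons_zero, Fin.cons_succ]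
    rw [h, norm_sub_sq_real]
    ring

lemma cmD_swap {N m : ℕ} (u : Option (Fin m) → Fin N → ℝ) (X Z : List (Option (Fin m)))
    (x y : Option (Fin m)) (h : X.length + Z.length + 2 = N) :
    cmD u (X ++ x :: y :: Z) = - cmD u (X ++ y :: x :: Z) := by
  have hne : (⟨X.length, by omega⟩ : Fin N) ≠ ⟨X.length + 1, by omega⟩ := by
    simp [Fin.ext_iff]
  have := Matrix.det_permute (Equiv.swap (⟨X.length, by omega⟩ : Fin N) ⟨X.length + 1, by omega⟩)
    (Matrix.of fun a b : Fin N => u ((X ++ y :: x :: Z).getD a none) b)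
  rw [Equiv.Perm.sign_swap hne] at this
  unfold cmD
  simp only [Units.val_neg, Units.val_one, Int.cast_neg, Int.cast_one, neg_mul, one_mul] at this
  rw [← this]
  congr 1
  ext a b
  simp only [Matrix.of_apply, Matrix.submatrix_apply, id]
  congr 1
  rw [Equiv.swap_apply_def]
  split_ifs with h1 h2
  · subst h1; simp
  · subst h2; simp
  · have h1' : (a : ℕ) ≠ X.length := fun h => h1 (Fin.ext h)
    have h2' : (a : ℕ) ≠ X.length + 1 := fun h => h2 (Fin.ext h)
    rcases lt_or_ge (a : ℕ) X.length with h3 | h3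
    · simp [List.getElem?_append_left h3]
    · obtain ⟨d, hd⟩ : ∃ d, (a : ℕ) = X.length + (d + 2) := ⟨a - X.length - 2, by omega⟩
      simp [hd, List.getElem?_append_right]

lemma cmD_shift {N m : ℕ} (u : Option (Fin m) → Fin N → ℝ) (x : Option (Fin m))
    (Y : List (Option (Fin m))) : ∀ (X Z : List (Option (Fin m))),
    X.length + Y.length + Z.length + 1 = N →
    cmD u (X ++ x :: (Y ++ Z)) = (-1) ^ Y.length * cmD u (X ++ (Y ++ x :: Z)) := by
  induction Y with
  | nil => intro X Z h; simp
  | cons y Y ih =>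
    intro X Z h
    simp only [List.length_cons] at h
    have h1 := cmD_swap u X (Y ++ Z) x y (by simp; omega)
    have h2 := ih (X ++ [y]) Z (by simp; omega)
    simp only [List.append_assoc, List.cons_append, List.nil_append, List.length_cons] at *
    rw [h1, h2]
    ring

lemma delSeq_split {n m q : ℕ} (hm : n + 1 ≤ m) (μ : Fin q → Fin (n + 1))
    (hμ : Function.Injective μ) (s : ℕ) (hs : s < q) :
    ∃ A C, delSeq hm μ s = A ++ some (Fin.castLE hm (μ ⟨s, hs⟩)) :: C ∧
      delSeq hm μ (s + 1) = A ++ C := by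
  set L := (List.finRange (n + 1)).filter fun a => a ∉ (List.ofFn μ).take s with hL
  have hnd : L.Nodup := (List.nodup_finRange _).filter _
  have htake : (List.ofFn μ).take (s + 1) = (List.ofFn μ).take s ++ [μ ⟨s, hs⟩] := by
    rw [List.take_succ_eq_append_getElem (by simpa using hs)]
    simp
  have hnd2 : ((List.ofFn μ).take (s + 1)).Nodup :=
    (List.nodup_ofFn.2 hμ).sublist (List.take_sublist _ _)
  have hmem : μ ⟨s, hs⟩ ∈ L := by
    rw [htake, List.nodup_append] at hnd2
    simp only [hL, List.mem_filter, List.mem_finRange, true_and, decide_eq_true_eq]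
    intro h
    exact hnd2.2.2 _ h _ (by simp) rfl
  obtain ⟨A, C, -, h1, h2⟩ := List.exists_erase_eq hmem
  refine ⟨A.map fun a => some (Fin.castLE hm a), C.map fun a => some (Fin.castLE hm a), ?_, ?_⟩
  · rw [delSeq, ← hL, h1]; simp
  · rw [← List.map_append, ← h2, hnd.erase_eq_filter, hL, List.filter_filter, delSeq, htake]
    congr 1
    apply List.filter_congr
    intro a _
    simp [and_comm, not_or, bne, beq_eq_decide]

lemma delSeq_length {n m q : ℕ} (hm : n + 1 ≤ m) (μ : Fin q → Fin (n + 1))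
    (hμ : Function.Injective μ) (s : ℕ) (hs : s ≤ q) :
    (delSeq hm μ s).length + s = n + 1 := by
  induction s with
  | zero => simp [delSeq]
  | succ s ih =>
    obtain ⟨A, C, h1, h2⟩ := delSeq_split hm μ hμ s hs
    have := ih (by omega)
    rw [h1] at this
    rw [h2]
    simp at *
    omega

/-- The reversed initial segment of a sequence. -/
def revSeq {α : Type} {q : ℕ} (f : Fin q → α) (s : ℕ) (hs : s ≤ q) : List α :=
  List.ofFn fun t : Fin s => f ⟨s - 1 - (t : ℕ), by omega⟩

lemma revSeq_succ {α : Type} {q : ℕ} (f : Fin q → α) (s : ℕ) (hs : s + 1 ≤ q) :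
    revSeq f (s + 1) hs = f ⟨s, hs⟩ :: revSeq f s (by omega) := by
  unfold revSeq
  rw [List.ofFn_succ]
  congr 1
  congr 1
  funext t
  congr 2
  simp
  omega

lemma revSeq_length {α : Type} {q : ℕ} (f : Fin q → α) (s : ℕ) (hs : s ≤ q) :
    (revSeq f s hs).length = s := by simp [revSeq]

lemma exists_sign {n m q : ℕ} (hm : n + 1 ≤ m) (μ : Fin q → Fin (n + 1))
    (hμ : Function.Injective μ) (u : Option (Fin m) → Fin (n + 2) → ℝ) (i : Fin q) :
    ∃ ε : ℝ, ∀ L : List (Option (Fin m)), L.length = (i : ℕ) →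
      cmD u (none :: some (Fin.castLE hm (μ i)) :: L ++ delSeq hm μ ((i : ℕ) + 1)) =
        ε * cmD u (none :: L ++ delSeq hm μ (i : ℕ)) := by
  obtain ⟨A, C, h1, h2⟩ := delSeq_split hm μ hμ i i.2
  refine ⟨(-1) ^ ((i : ℕ) + A.length), fun L hL => ?_⟩
  have hl := delSeq_length hm μ hμ i i.2.le
  have := cmD_shift u (some (Fin.castLE hm (μ i))) (L ++ A) [none] C
    (by rw [h1] at hl; simp at *; omega)
  rw [h1, h2]
  simpa [hL] using this

lemma sign_prod {n m q : ℕ} (hm : n + 1 ≤ m) (μ : Fin q → Fin (n + 1))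
    (u : Option (Fin m) → Fin (n + 2) → ℝ) (ε : Fin q → ℝ)
    (hε : ∀ (i : Fin q) (L : List (Option (Fin m))), L.length = (i : ℕ) →
      cmD u (none :: some (Fin.castLE hm (μ i)) :: L ++ delSeq hm μ ((i : ℕ) + 1)) =
        ε i * cmD u (none :: L ++ delSeq hm μ (i : ℕ))) (s : ℕ) (hs : s ≤ q) :
    cmD u (none :: revSeq (fun i => some (Fin.castLE hm (μ i))) s hs ++ delSeq hm μ s) =
      (∏ i : Fin s, ε (Fin.castLE hs i)) * cmD u (none :: delSeq hm μ 0) := by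
  induction s with
  | zero => simp [revSeq]
  | succ s ih =>
    have h := ih (by omega)
    rw [revSeq_succ, hε ⟨s, hs⟩ _ (revSeq_length _ _ _)]
    simp only at h ⊢
    rw [h, Fin.prod_univ_castSucc]
    simp only [Fin.castLE_castSucc]
    have : Fin.castLE hs (Fin.last s) = ⟨s, hs⟩ := rfl
    rw [this]
    ring

/-- Lemma 40 (identities (60)/(61)) of Aomoto–Machida: for points `P_1,…,P_m ∈ ℝⁿ`,
distinct `μ_1,…,μ_q ∈ N = (1,…,n+1)` (`1 ≤ q ≤ n`) and distinct `k_1,…,k_q ∈ {n+2,…,m}`: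
`∏_{s=1}^{q} B(0 k_s…k_1 ∂_{μ_s}⋯∂_{μ_1}N ; 0 μ_s k_{s−1}…k_1 ∂_{μ_s}⋯∂_{μ_1}N)
  = B(0 k_q…k_1 ∂_{μ_q}⋯∂_{μ_1}N ; 0 μ_q…μ_1 ∂_{μ_q}⋯∂_{μ_1}N)
      · ∏_{s=1}^{q−1} B(0 k_s…k_1 ∂_{μ_s}⋯∂_{μ_1}N)`. -/
theorem cm_points_product_identity (n m q : ℕ) (hq1 : 1 ≤ q) (hqn : q ≤ n)
    (hm : n + 1 ≤ m) (P : Fin m → EuclideanSpace ℝ (Fin n))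
    (μ : Fin q → Fin (n + 1)) (hμ : Function.Injective μ)
    (kf : Fin q → Fin m) (hkf : Function.Injective kf)
    (hk : ∀ t, n + 1 ≤ ((kf t : Fin m) : ℕ)) :
    (∏ i : Fin q,
      pMinor P
        ((none : Option (Fin m)) ::
          (List.ofFn fun t : Fin ((i : ℕ) + 1) =>
            some (kf ⟨(i : ℕ) - (t : ℕ), by omega⟩)) ++
          delSeq hm μ ((i : ℕ) + 1))
        ((none : Option (Fin m)) :: some (Fin.castLE hm (μ i)) ::
          (List.ofFn fun t : Fin (i : ℕ) =>
            some (kf ⟨(i : ℕ) - 1 - (t : ℕ), by omega⟩)) ++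
          delSeq hm μ ((i : ℕ) + 1))) =
    pMinor P
        ((none : Option (Fin m)) ::
          (List.ofFn fun t : Fin q => some (kf ⟨q - 1 - (t : ℕ), by omega⟩)) ++
          delSeq hm μ q)
        ((none : Option (Fin m)) ::
          (List.ofFn fun t : Fin q =>
            some (Fin.castLE hm (μ ⟨q - 1 - (t : ℕ), by omega⟩))) ++
          delSeq hm μ q) *
      ∏ i : Fin (q - 1),
        pMinor P
          ((none : Option (Fin m)) ::
            (List.ofFn fun t : Fin ((i : ℕ) + 1) =>
              some (kf ⟨(i : ℕ) - (t : ℕ), by omega⟩)) ++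
            delSeq hm μ ((i : ℕ) + 1))
          ((none : Option (Fin m)) ::
            (List.ofFn fun t : Fin ((i : ℕ) + 1) =>
              some (kf ⟨(i : ℕ) - (t : ℕ), by omega⟩)) ++
            delSeq hm μ ((i : ℕ) + 1)) := by
  choose ε hε using exists_sign hm μ hμ (cmV P)
  obtain ⟨p, rfl⟩ : ∃ p, q = p + 1 := ⟨q - 1, by omega⟩
  let K : ∀ s, s ≤ p + 1 → List (Option (Fin m)) := fun s hs =>
    none :: revSeq (fun i => some (kf i)) s hs ++ delSeq hm μ s
  have hKl : ∀ s hs, (K s hs).length = n + 2 := by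
    intro s hs
    have := delSeq_length hm μ hμ s hs
    simp [K, revSeq_length]
    omega
  have e1 : ∀ i : Fin (p + 1), pMinor P (K ((i : ℕ) + 1) i.2)
      (none :: some (Fin.castLE hm (μ i)) :: revSeq (fun i => some (kf i)) i i.2.le ++
        delSeq hm μ ((i : ℕ) + 1)) =
      cmD (cmU P) (K ((i : ℕ) + 1) i.2) * (ε i * cmD (cmV P) (K i i.2.le)) := by
    intro i
    rw [pMinor_factor P _ _ (hKl _ _), hε i _ (revSeq_length _ _ _)]
    have := delSeq_length hm μ hμ (i + 1) i.2
    simp [revSeq_length]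
    omega
  have e2 : pMinor P (K (p + 1) le_rfl)
      (none :: revSeq (fun i => some (Fin.castLE hm (μ i))) (p + 1) le_rfl ++
        delSeq hm μ (p + 1)) =
      cmD (cmU P) (K (p + 1) le_rfl) *
        ((∏ i : Fin (p + 1), ε i) * cmD (cmV P) (K 0 (by omega))) := by
    rw [pMinor_factor P _ _ (hKl _ _), sign_prod hm μ (cmV P) ε hε]
    · rfl
    have := delSeq_length hm μ hμ (p + 1) le_rfl
    simp [revSeq_length]
    omega
  have e3 : ∀ i : Fin p, pMinor P (K ((i : ℕ) + 1) (by omega)) (K ((i : ℕ) + 1) (by omega)) =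
      cmD (cmU P) (K ((i : ℕ) + 1) (by omega)) * cmD (cmV P) (K ((i : ℕ) + 1) (by omega)) :=
    fun i => pMinor_factor P _ _ (hKl _ _) (hKl _ _)
  refine (Finset.prod_congr rfl fun i _ => e1 i).trans ?_
  refine Eq.trans ?_ (congrArg₂ (· * ·) e2 (Finset.prod_congr rfl fun i _ => e3 i)).symm
  simp only [Finset.prod_mul_distrib]
  rw [Fin.prod_univ_castSucc (fun i : Fin (p + 1) => cmD (cmU P) (K ((i : ℕ) + 1) i.2)),
    Fin.prod_univ_succ (fun i : Fin (p + 1) => cmD (cmV P) (K i i.2.le))]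
  simp only [Fin.val_castSucc, Fin.val_succ, Fin.val_last, Fin.val_zero]
  ring
end
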